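/- arXiv:0904.1176 — 3 statements merged into one kernel-verified Lean document; each statement's English description precedes it below -/
import Mathlib

section
/- Space-fractional governing equation for a spectrally negative stable density: Let 1 < α < 2, b > 0, and let P(x,t) = p_α(x; 2−α, b^{−α} t). Then for all real x and all t > 0, (∂P/∂t)(x,t) = b^{−α} · (1/Γ(2−α)) · (d²/dx²) ∫_x^∞ P(y,t)(y−x)^{1−α} dy. -/
open MeasureTheory Real Set

/-- Zolotarev's parametrization of the stable density: the real-valued inverse Fourier
integral `p_α(x; η, b) = (1/(2π)) ∫ e^{-iλx} exp(-b|λ|^α e^{-iπη·sgn(λ)/2}) dλ`. -/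
noncomputable def zolDensity (α η b x : ℝ) : ℝ :=
  (1 / (2 * Real.pi)) *
    (∫ l : ℝ, Complex.exp (-Complex.I * (l : ℂ) * (x : ℂ)) *
        Complex.exp (-(b : ℂ) * ((|l| ^ α : ℝ) : ℂ) *
          Complex.exp (-Complex.I * (Real.pi : ℂ) * (η : ℂ) * ((Real.sign l : ℝ) : ℂ) / 2))).re




lemma aux_int_gamma (a c : ℝ) (ha : -1 < a) (hc : 0 < c) :
    IntegrableOn (fun u : ℝ => u ^ a * Real.exp (-c * u)) (Ioi 0) := by
  have := integrableOn_rpow_mul_exp_neg_mul_rpow (p := 1) ha one_pos hc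
  simpa using this

lemma aux_meas (a : ℝ) (s : ℂ) : AEStronglyMeasurable
    (fun u : ℝ => ((u ^ a : ℝ) : ℂ) * Complex.exp (-(s * u))) (volume.restrict (Ioi 0)) := by
  apply Measurable.aestronglyMeasurable
  fun_prop

lemma aux_norm (a u : ℝ) (hu : 0 < u) (s : ℂ) :
    ‖((u ^ a : ℝ) : ℂ) * Complex.exp (-(s * u))‖ = u ^ a * Real.exp (-s.re * u) := by
  rw [norm_mul, Complex.norm_exp, Complex.norm_real, Real.norm_of_nonneg (by positivity)]
  simp

lemma aux_int_cgamma (a : ℝ) (ha : -1 < a) (s : ℂ) (hs : 0 < s.re) :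
    IntegrableOn (fun u : ℝ => ((u ^ a : ℝ) : ℂ) * Complex.exp (-(s * u))) (Ioi 0) := by
  refine (aux_int_gamma a s.re ha hs).mono' (aux_meas a s) ?_
  filter_upwards [ae_restrict_mem measurableSet_Ioi] with u hu
  exact (aux_norm a u hu s).le

lemma aux_diff (a : ℝ) (ha : -1 < a) (s : ℂ) (hs : 0 < s.re) :
    DifferentiableAt ℂ (fun s : ℂ => ∫ u in Ioi (0:ℝ), ((u ^ a : ℝ) : ℂ) * Complex.exp (-(s * u))) s := by
  have hmem : {z : ℂ | s.re / 2 < z.re} ∈ nhds s :=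
    (isOpen_lt continuous_const Complex.continuous_re).mem_nhds (by simp; linarith)
  refine ((hasDerivAt_integral_of_dominated_loc_of_deriv_le
    (F' := fun z u => -(((u ^ (a+1) : ℝ) : ℂ) * Complex.exp (-(z * u))))
    (bound := fun u => u ^ (a+1) * Real.exp (-(s.re/2) * u)) hmem ?_ ?_ ?_ ?_ ?_ ?_).2).differentiableAt
  · exact Filter.Eventually.of_forall fun z => aux_meas a z
  · exact aux_int_cgamma a ha s hs
  · exact (aux_meas _ _).neg
  · filter_upwards [ae_restrict_mem measurableSet_Ioi] with u hu z hz
    rw [norm_neg, aux_norm _ _ hu]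
    have : (0:ℝ) < u := hu
    have hz' : s.re / 2 < z.re := hz
    gcongr
  · exact aux_int_gamma _ _ (by linarith) (by linarith)
  · filter_upwards [ae_restrict_mem measurableSet_Ioi] with u hu z hz
    have hu' : (0:ℝ) < u := hu
    have h1 : HasDerivAt (fun z : ℂ => -(z * u)) (-(1 * (u:ℂ))) z := ((hasDerivAt_id z).mul_const _).neg
    have := (h1.cexp).const_mul ((u ^ a : ℝ) : ℂ)
    have e : -(((u ^ (a+1) : ℝ) : ℂ) * Complex.exp (-(z * u))) =
        ((u ^ a : ℝ) : ℂ) * (Complex.exp (-(z * u)) * -(1 * (u:ℂ))) := by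
      rw [Real.rpow_add hu', Real.rpow_one]; push_cast; ring
    rw [e]; exact this

lemma aux_gamma (a : ℝ) (ha : -1 < a) (s : ℂ) (hs : 0 < s.re) :
    ∫ u in Ioi (0:ℝ), ((u ^ a : ℝ) : ℂ) * Complex.exp (-(s * u)) =
      (Real.Gamma (a + 1) : ℂ) * s ^ ((-(a + 1) : ℝ) : ℂ) := by
  have hopen : IsOpen {z : ℂ | 0 < z.re} := isOpen_lt continuous_const Complex.continuous_re
  have key : EqOn (fun s : ℂ => ∫ u in Ioi (0:ℝ), ((u ^ a : ℝ) : ℂ) * Complex.exp (-(s * u)))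
      (fun s : ℂ => (Real.Gamma (a + 1) : ℂ) * s ^ ((-(a + 1) : ℝ) : ℂ)) {z : ℂ | 0 < z.re} := by
    refine AnalyticOnNhd.eqOn_of_preconnected_of_frequently_eq (z₀ := 1) ?_ ?_ ?_ ?_ ?_
    · refine DifferentiableOn.analyticOnNhd ?_ hopen
      exact fun z hz => (aux_diff a ha z hz).differentiableWithinAt
    · refine DifferentiableOn.analyticOnNhd ?_ hopen
      intro z hz
      refine DifferentiableAt.differentiableWithinAt ?_
      refine DifferentiableAt.const_mul ?_ _
      exact (DifferentiableAt.cpow_const differentiableAt_id (Or.inl hz))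
    · exact (convex_halfSpace_re_gt 0).isPreconnected
    · simp
    · have hT : Filter.Tendsto (fun n : ℝ => (n : ℂ)) (nhdsWithin 1 (Ioi 1)) (nhdsWithin 1 {1}ᶜ) := by
        refine tendsto_nhdsWithin_iff.2 ⟨?_, ?_⟩
        · exact (Complex.continuous_ofReal.tendsto' 1 1 (by simp)).mono_left nhdsWithin_le_nhds
        · filter_upwards [self_mem_nhdsWithin] with r hr
          simp only [mem_compl_iff, mem_singleton_iff]
          intro h
          have : r = 1 := by exact_mod_cast h
          exact (ne_of_gt hr) this
      refine hT.frequently (Filter.Eventually.frequently ?_)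
      filter_upwards [self_mem_nhdsWithin] with r hr
      have hr0 : 0 < r := lt_trans one_pos hr
      have := Real.integral_rpow_mul_exp_neg_mul_Ioi (a := a + 1) (by linarith) hr0
      have e : ∀ u : ℝ, ((u ^ a : ℝ) : ℂ) * Complex.exp (-((r:ℂ) * u)) =
        ((u ^ (a + 1 - 1) * Real.exp (-(r * u)) : ℝ) : ℂ) := by
        intro u; push_cast; simp
      simp_rw [e]
      rw [integral_complex_ofReal, this, ← Complex.ofReal_cpow hr0.le, ← Complex.ofReal_mul,
        one_div, Real.inv_rpow hr0.le, Real.rpow_neg hr0.le, mul_comm]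
  exact key hs

lemma aux_abs {f : ℝ → ℝ} (hf : IntegrableOn f (Ioi 0)) : Integrable (fun x => f |x|) := by
  have h1 : IntegrableOn (fun x => f |x|) (Ioi 0) :=
    hf.congr_fun (fun x hx => by simp [abs_of_pos (show (0:ℝ) < x from hx)]) measurableSet_Ioi
  have int_Iic : IntegrableOn (fun x ↦ f |x|) (Iic 0) := by
      rw [← Measure.map_neg_eq_self (volume : Measure ℝ)]
      let m : MeasurableEmbedding fun x : ℝ => -x := (Homeomorph.neg ℝ).measurableEmbedding
      rw [m.integrableOn_map_iff]
      simp_rw [Function.comp_def, abs_neg, neg_preimage, neg_Iic, neg_zero]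
      exact Iff.mpr integrableOn_Ici_iff_integrableOn_Ioi h1
  have := int_Iic.union h1
  rwa [Iic_union_Ioi, integrableOn_univ] at this

lemma aux_major (α c : ℝ) (hα : 0 < α) (hc : 0 < c) :
    Integrable (fun l : ℝ => (1 + |l|) ^ 2 * Real.exp (-c * |l| ^ α)) := by
  have h0 := integrableOn_rpow_mul_exp_neg_mul_rpow (p := α) (s := 0) (by norm_num) hα hc
  have h1 := integrableOn_rpow_mul_exp_neg_mul_rpow (p := α) (s := 1) (by norm_num) hα hc
  have h2 := integrableOn_rpow_mul_exp_neg_mul_rpow (p := α) (s := 2) (by norm_num) hα hc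
  have := ((aux_abs h0).add ((aux_abs h1).const_mul 2)).add (aux_abs h2)
  refine this.congr (Filter.Eventually.of_forall fun x => ?_)
  have := sq_abs x
  simp
  rw [← this]; ring

/-- the imaginary axis value -/
lemma aux_axis (α : ℝ) (hα : 0 < α) (l : ℝ) :
    ((l : ℂ) * Complex.I) ^ (α : ℂ) =
      -((|l| ^ α : ℝ) : ℂ) * Complex.exp (-Complex.I * (Real.pi : ℂ) * ((2 - α : ℝ) : ℂ) *
        ((Real.sign l : ℝ) : ℂ) / 2) := by
  rcases lt_trichotomy l 0 with h | rfl | h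
  · have e : (l : ℂ) * Complex.I = ((-l : ℝ) : ℂ) * (-Complex.I) := by push_cast; ring
    rw [e, Complex.cpow_def_of_ne_zero (by simp [h.ne]), Complex.log_ofReal_mul (by linarith) (by simp),
      Complex.log_neg_I, Real.sign_of_neg h, abs_of_neg h, Real.rpow_def_of_pos (by linarith), add_mul,
      Complex.exp_add, neg_mul _ (Complex.exp _)]
    push_cast
    rw [← mul_neg]
    congr 1
    rw [show -Complex.I * (Real.pi:ℂ) * (2 - α) * (-1) / 2 = Real.pi * Complex.I + (-(Real.pi/2) * Complex.I * α) by ring,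
      Complex.exp_add, Complex.exp_pi_mul_I]
    ring
  · simp [hα.ne']
  · rw [Complex.cpow_def_of_ne_zero (by simp [h.ne']), Complex.log_ofReal_mul (by linarith) (by simp),
      Complex.log_I, Real.sign_of_pos h, abs_of_pos h, Real.rpow_def_of_pos (by linarith), add_mul,
      Complex.exp_add, neg_mul _ (Complex.exp _)]
    push_cast
    rw [← mul_neg]
    congr 1
    rw [show -Complex.I * (Real.pi:ℂ) * (2 - α) * 1 / 2 = -(Real.pi * Complex.I) + ((Real.pi/2) * Complex.I * α) by ring,
      Complex.exp_add, Complex.exp_neg, Complex.exp_pi_mul_I]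
    norm_num

lemma aux_axis_re (α : ℝ) (hα : 0 < α) (l : ℝ) :
    (((l : ℂ) * Complex.I) ^ (α : ℂ)).re = Real.cos (Real.pi * α / 2) * |l| ^ α := by
  rcases eq_or_ne l 0 with rfl | h
  · simp [hα.ne']
  rw [aux_axis α hα]
  rw [show -Complex.I * (Real.pi : ℂ) * ((2 - α : ℝ) : ℂ) * ((Real.sign l : ℝ) : ℂ) / 2 =
    ((-(Real.pi * (2 - α) * Real.sign l / 2) : ℝ) : ℂ) * Complex.I by push_cast; ring]
  rw [← Complex.ofReal_neg, Complex.re_ofReal_mul, Complex.exp_ofReal_mul_I_re, Real.cos_neg]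
  have : Real.cos (Real.pi * (2 - α) * Real.sign l / 2) = - Real.cos (Real.pi * α / 2) := by
    have h1 : Real.cos (Real.pi * (2 - α) / 2) = - Real.cos (Real.pi * α / 2) := by
      rw [show Real.pi * (2 - α) / 2 = Real.pi - Real.pi * α / 2 by ring, Real.cos_pi_sub]
    rcases Real.sign_apply_eq_of_ne_zero l h with h' | h'
    · rw [h', ← h1, ← Real.cos_neg]; congr 1; ring
    · rw [h', ← h1]; congr 1; ring
  rw [this]; ring

lemma aux_bound (α : ℝ) (hα1 : 1 < α) (hα2 : α < 2) :
    ∃ κ C : ℝ, 0 < κ ∧ ∀ u ∈ Icc (0:ℝ) 1, ∀ l : ℝ,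
      (((u:ℂ) + (l : ℂ) * Complex.I) ^ (α : ℂ)).re ≤ C - κ * |l| ^ α := by
  have hcos : Real.cos (Real.pi * α / 2) < 0 := by
    apply Real.cos_neg_of_pi_div_two_lt_of_lt <;> nlinarith [Real.pi_pos]
  set κ := - Real.cos (Real.pi * α / 2) / 2 with hκ
  have hκ0 : 0 < κ := by rw [hκ]; linarith
  set ε := κ / α with hε
  have hε0 : 0 < ε := by positivity
  refine ⟨κ, α * (1 + (1/ε)^(α-1)), hκ0, ?_⟩
  intro u hu l
  have hY : ∀ r : ℝ, 0 ≤ r → r ^ (α - 1) ≤ ε * r ^ α + (1/ε)^(α-1) := by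
    intro r hr
    rcases le_total r (1/ε) with h | h
    · have := Real.rpow_le_rpow hr h (by linarith : 0 ≤ α - 1)
      have : 0 ≤ ε * r ^ α := by positivity
      linarith
    · have hr0 : 0 < r := lt_of_lt_of_le (by positivity) h
      have h2 : r ^ α = r ^ (α - 1) * r := by
        rw [Real.rpow_sub_one hr0.ne']; field_simp
      have h3 : 1 ≤ ε * r := by rw [div_le_iff₀ hε0] at h; linarith
      have h4 : 0 ≤ r ^ (α - 1) := by positivity
      have : 0 ≤ (1/ε)^(α-1) := by positivity
      rw [h2]; nlinarith
  have hMVT : ‖((u:ℂ) + (l : ℂ) * Complex.I) ^ (α : ℂ) - ((l : ℂ) * Complex.I) ^ (α : ℂ)‖ ≤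
      α * (1 + |l|) ^ (α - 1) := by
    rcases eq_or_ne l 0 with rfl | hl
    · have : α ≠ 0 := by linarith
      have h0 : u ^ α ≤ 1 := Real.rpow_le_one hu.1 hu.2 (by linarith)
      simp only [Complex.ofReal_zero, zero_mul, add_zero, abs_zero, Real.one_rpow, mul_one]
      rw [Complex.zero_cpow (by simpa using this), sub_zero, Complex.norm_cpow_real, Complex.norm_real,
        Real.norm_of_nonneg hu.1]
      linarith
    · have hs : ∀ v : ℝ, ((v:ℂ) + (l : ℂ) * Complex.I) ∈ Complex.slitPlane := by
        intro v; right; simpa using hl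
      have hd : ∀ v ∈ Icc (0:ℝ) 1, HasDerivWithinAt (fun v : ℝ => ((v:ℂ) + (l : ℂ) * Complex.I) ^ (α : ℂ))
          (α * ((v:ℂ) + (l : ℂ) * Complex.I) ^ ((α:ℂ) - 1)) (Icc 0 1) v := by
        intro v _
        have h1 : HasDerivAt (fun v : ℂ => v + (l : ℂ) * Complex.I) 1 (v:ℂ) := (hasDerivAt_id _).add_const _
        have := (h1.cpow_const (c := (α:ℂ)) (hs v)).comp_ofReal
        simpa using this.hasDerivWithinAt
      have := Convex.norm_image_sub_le_of_norm_hasDerivWithin_le (C := α * (1 + |l|) ^ (α - 1)) hd ?_ (convex_Icc 0 1)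
        (left_mem_Icc.2 zero_le_one) hu
      · simp only [Complex.ofReal_zero, zero_add, sub_zero] at this
        refine this.trans ?_
        rw [Real.norm_of_nonneg hu.1]
        have : 0 ≤ α * (1 + |l|) ^ (α - 1) := by positivity
        nlinarith [hu.2]
      · intro v hv
        rw [show (α:ℂ) - 1 = ((α - 1 : ℝ) : ℂ) by push_cast; rfl, norm_mul, Complex.norm_cpow_real,
          Complex.norm_real, Real.norm_of_nonneg (by linarith)]
        gcongr
        · refine (norm_add_le _ _).trans ?_
          simp only [Complex.norm_real, norm_mul, Complex.norm_I, mul_one]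
          rw [Real.norm_of_nonneg hv.1, Real.norm_eq_abs]
          linarith [hv.2]
  have h1 := (Complex.re_le_norm _).trans hMVT
  rw [Complex.sub_re, aux_axis_re α (by linarith)] at h1
  have h2 := Real.rpow_add_le_add_rpow (zero_le_one) (abs_nonneg l) (by linarith : 0 ≤ α - 1) (by linarith)
  have h3 := hY |l| (abs_nonneg l)
  rw [Real.one_rpow] at h2
  have h4 : α * (1 + |l|) ^ (α - 1) ≤ α * (1 + (ε * |l| ^ α + (1/ε)^(α-1))) := by
    gcongr; linarith
  have h5 : α * (ε * |l|^α) = κ * |l|^α := by rw [hε]; field_simp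
  have h6 : Real.cos (Real.pi * α / 2) = -2 * κ := by rw [hκ]; ring
  rw [h6] at h1
  nlinarith

/-- the shifted integrand -/
noncomputable def stW (α β B x l : ℝ) : ℂ :=
  Complex.exp (-((1 + (l:ℂ) * Complex.I) * x)) * (1 + (l:ℂ) * Complex.I) ^ (β : ℂ) *
    Complex.exp (B * (1 + (l:ℂ) * Complex.I) ^ (α : ℂ))

lemma one_add_slit (l : ℝ) : (1 + (l:ℂ) * Complex.I) ∈ Complex.slitPlane := by
  left; simp

lemma cont_cpow1 (β : ℝ) : Continuous fun l : ℝ => (1 + (l:ℂ) * Complex.I) ^ (β : ℂ) := by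
  refine Continuous.cpow (by fun_prop) continuous_const fun l => one_add_slit l

lemma cont_stW (α β B x : ℝ) : Continuous (stW α β B x) := by
  have h1 := cont_cpow1 α
  have h2 := cont_cpow1 β
  unfold stW
  fun_prop

lemma norm_stW_le (α β B x l κ C : ℝ) (hβ : β ≤ 2) (hB : 0 ≤ B)
    (hb : ((1 + (l : ℂ) * Complex.I) ^ (α : ℂ)).re ≤ C - κ * |l| ^ α) :
    ‖stW α β B x l‖ ≤ Real.exp (-x + B * C) * ((1 + |l|) ^ 2 * Real.exp (-(B * κ) * |l| ^ α)) := by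
  have h1 : (1:ℝ) ≤ ‖1 + (l:ℂ) * Complex.I‖ := by
    have := Complex.re_le_norm (1 + (l:ℂ) * Complex.I)
    simpa using this
  have h2 : ‖1 + (l:ℂ) * Complex.I‖ ≤ 1 + |l| := by
    refine (norm_add_le _ _).trans ?_
    simp
  have h3 : ‖1 + (l:ℂ) * Complex.I‖ ^ β ≤ (1 + |l|) ^ 2 := by
    calc ‖1 + (l:ℂ) * Complex.I‖ ^ β ≤ ‖1 + (l:ℂ) * Complex.I‖ ^ (2:ℝ) := Real.rpow_le_rpow_of_exponent_le h1 hβ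
      _ = ‖1 + (l:ℂ) * Complex.I‖ ^ 2 := by norm_cast
      _ ≤ _ := by gcongr
  unfold stW
  rw [norm_mul, norm_mul, Complex.norm_exp, Complex.norm_exp, Complex.norm_cpow_real]
  have e1 : (-((1 + (l:ℂ) * Complex.I) * x)).re = -x := by simp
  rw [e1, Complex.re_ofReal_mul]
  calc Real.exp (-x) * ‖1 + (l:ℂ) * Complex.I‖ ^ β * Real.exp (B * ((1 + (l : ℂ) * Complex.I) ^ (α : ℂ)).re)
      ≤ Real.exp (-x) * (1 + |l|) ^ 2 * Real.exp (B * (C - κ * |l| ^ α)) := by gcongr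
    _ = _ := by
      rw [show B * (C - κ * |l| ^ α) = B * C + -(B * κ) * |l| ^ α by ring, Real.exp_add, Real.exp_add]
      ring

lemma bound_one (α : ℝ) (hα1 : 1 < α) (hα2 : α < 2) :
    ∃ κ C : ℝ, 0 < κ ∧ ∀ l : ℝ,
      ((1 + (l : ℂ) * Complex.I) ^ (α : ℂ)).re ≤ C - κ * |l| ^ α := by
  obtain ⟨κ, C, h, h'⟩ := aux_bound α hα1 hα2
  refine ⟨κ, C, h, fun l => ?_⟩
  simpa using h' 1 (by simp) l

lemma int_stW (α β B x : ℝ) (hα1 : 1 < α) (hα2 : α < 2) (hβ : β ≤ 2) (hB : 0 < B) :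
    Integrable (stW α β B x) := by
  obtain ⟨κ, C, hκ, h⟩ := bound_one α hα1 hα2
  refine ((aux_major α (B * κ) (by linarith) (by positivity)).const_mul (Real.exp (-x + B * C))).mono'
    (cont_stW α β B x).aestronglyMeasurable (Filter.Eventually.of_forall fun l => ?_)
  exact norm_stW_le α β B x l κ C hβ hB.le (h l)

lemma deriv_x (α β B x : ℝ) (hα1 : 1 < α) (hα2 : α < 2) (hβ : β + 1 ≤ 2) (hB : 0 < B) :
    HasDerivAt (fun x => ∫ l, stW α β B x l) (-∫ l, stW α (β + 1) B x l) x := by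
  obtain ⟨κ, C, hκ, h⟩ := bound_one α hα1 hα2
  rw [← integral_neg]
  refine (hasDerivAt_integral_of_dominated_loc_of_deriv_le (F := fun x l => stW α β B x l)
    (F' := fun x l => -stW α (β+1) B x l)
    (bound := fun l => Real.exp (-(x-1) + B * C) * ((1 + |l|) ^ 2 * Real.exp (-(B * κ) * |l| ^ α)))
    (Ioi_mem_nhds (show x - 1 < x by linarith)) ?_ ?_ ?_ ?_ ?_ ?_).2
  · exact Filter.Eventually.of_forall fun z => (cont_stW α β B z).aestronglyMeasurable
  · exact int_stW α β B x hα1 hα2 (by linarith) hB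
  · exact (cont_stW α _ B x).aestronglyMeasurable.neg
  · refine Filter.Eventually.of_forall fun l z hz => ?_
    have hz' : x - 1 < z := hz
    rw [norm_neg]
    refine (norm_stW_le α (β+1) B z l κ C hβ hB.le (h l)).trans ?_
    gcongr
  · exact (aux_major α (B * κ) (by linarith) (by positivity)).const_mul _
  · refine Filter.Eventually.of_forall fun l z hz => ?_
    have h0 : (1 + (l:ℂ) * Complex.I) ≠ 0 := Complex.slitPlane_ne_zero (one_add_slit l)
    have h1 : HasDerivAt (fun z : ℝ => -((1 + (l:ℂ) * Complex.I) * (z:ℂ))) (-((1 + (l:ℂ) * Complex.I) * (1:ℝ))) z :=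
      ((hasDerivAt_id z).ofReal_comp.const_mul _).neg
    have h2 := (h1.cexp.mul_const ((1 + (l:ℂ) * Complex.I) ^ (β : ℂ))).mul_const
      (Complex.exp (B * (1 + (l:ℂ) * Complex.I) ^ (α : ℂ)))
    have e : -stW α (β+1) B z l = Complex.exp (-((1 + (l:ℂ) * Complex.I) * (z:ℂ))) *
        -((1 + (l:ℂ) * Complex.I) * (1:ℝ)) * ((1 + (l:ℂ) * Complex.I) ^ (β : ℂ)) *
        (Complex.exp (B * (1 + (l:ℂ) * Complex.I) ^ (α : ℂ))) := by
      unfold stW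
      rw [Complex.ofReal_add, Complex.cpow_add _ _ h0]
      simp; ring
    simp only [e]
    exact h2

lemma deriv_B (α B x : ℝ) (hα1 : 1 < α) (hα2 : α < 2) (hB : 0 < B) :
    HasDerivAt (fun B => ∫ l, stW α 0 B x l) (∫ l, stW α α B x l) B := by
  obtain ⟨κ, C, hκ, h⟩ := bound_one α hα1 hα2
  have hC : 0 ≤ |C| := abs_nonneg _
  refine (hasDerivAt_integral_of_dominated_loc_of_deriv_le (F := fun B l => stW α 0 B x l)
    (F' := fun B l => stW α α B x l)
    (bound := fun l => Real.exp (-x + (2 * B) * |C|) * ((1 + |l|) ^ 2 * Real.exp (-(B / 2 * κ) * |l| ^ α)))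
    (Ioo_mem_nhds (show B / 2 < B by linarith) (show B < 2 * B by linarith)) ?_ ?_ ?_ ?_ ?_ ?_).2
  · exact Filter.Eventually.of_forall fun z => (cont_stW α 0 z x).aestronglyMeasurable
  · exact int_stW α 0 B x hα1 hα2 (by linarith) hB
  · exact (cont_stW α _ B x).aestronglyMeasurable
  · refine Filter.Eventually.of_forall fun l z hz => ?_
    have hz0 : 0 < z := by linarith [hz.1]
    refine (norm_stW_le α α z x l κ C hα2.le hz0.le (h l)).trans ?_
    have h1 : z * C ≤ 2 * B * |C| := by
      have := hz.2
      calc z * C ≤ z * |C| := by gcongr; exact le_abs_self C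
        _ ≤ _ := by gcongr
    have h2 := hz.1
    gcongr
  · exact (aux_major α (B / 2 * κ) (by linarith) (by positivity)).const_mul _
  · refine Filter.Eventually.of_forall fun l z hz => ?_
    have h1 : HasDerivAt (fun z : ℝ => (z:ℂ) * (1 + (l:ℂ) * Complex.I) ^ (α : ℂ))
        ((1:ℝ) * (1 + (l:ℂ) * Complex.I) ^ (α : ℂ)) z :=
      ((hasDerivAt_id z).ofReal_comp.mul_const _)
    have h2 := h1.cexp.const_mul (Complex.exp (-((1 + (l:ℂ) * Complex.I) * x)) * (1 + (l:ℂ) * Complex.I) ^ ((0:ℝ) : ℂ))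
    have e : stW α α z x l = (Complex.exp (-((1 + (l:ℂ) * Complex.I) * x)) * (1 + (l:ℂ) * Complex.I) ^ ((0:ℝ) : ℂ)) *
       (Complex.exp (z * (1 + (l:ℂ) * Complex.I) ^ (α : ℂ)) * ((1:ℝ) * (1 + (l:ℂ) * Complex.I) ^ (α : ℂ))) := by
      unfold stW
      simp; ring
    simp only [e]
    exact h2

/-- contour shift -/
lemma shift (α B x : ℝ) (hα1 : 1 < α) (hα2 : α < 2) (hB : 0 < B) :
    ∫ l : ℝ, Complex.exp (-(((l:ℂ) * Complex.I) * x)) * Complex.exp (B * ((l:ℂ) * Complex.I) ^ (α : ℂ)) =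
      ∫ l, stW α 0 B x l := by
  obtain ⟨κ, C, hκ, h⟩ := aux_bound α hα1 hα2
  set g : ℂ → ℂ := fun s => Complex.exp (-(s * x)) * Complex.exp (B * s ^ (α : ℂ)) with hg
  have hgn : ∀ u ∈ Icc (0:ℝ) 1, ∀ l : ℝ, ‖g (u + l * Complex.I)‖ ≤
      Real.exp (|x| + B * C) * Real.exp (-(B * κ) * |l| ^ α) := by
    intro u hu l
    rw [hg]
    simp only
    rw [norm_mul, Complex.norm_exp, Complex.norm_exp, ← Real.exp_add, ← Real.exp_add, Complex.re_ofReal_mul]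
    have e1 : (-((u + (l:ℂ) * Complex.I) * x)).re = -(u * x) := by simp
    rw [e1]
    apply Real.exp_le_exp.2
    have h1 : -(u * x) ≤ |x| := by
      have : |u * x| ≤ |x| := by
        rw [abs_mul, abs_of_nonneg hu.1]
        have := abs_nonneg x
        nlinarith [hu.2]
      linarith [neg_abs_le (u * x)]
    have h2 : B * (((u:ℂ) + l * Complex.I) ^ (α : ℂ)).re ≤ B * (C - κ * |l| ^ α) := by
      gcongr; exact h u hu l
    linarith
  have hgc : ∀ s : ℂ, 0 ≤ s.re → ContinuousAt g s := by
    intro s hs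
    have hp : ContinuousAt (fun s : ℂ => s ^ (α : ℂ)) s := by
      rcases eq_or_ne s 0 with rfl | hs0
      · have := Complex.continuousAt_cpow_zero_of_re_pos (z := (α:ℂ)) (by simp; linarith)
        exact ContinuousAt.comp (f := fun s : ℂ => (s, (α:ℂ))) this (by fun_prop)
      · refine continuousAt_id.cpow continuousAt_const ?_
        by_cases hr : 0 < s.re
        · exact Or.inl hr
        · right
          intro him
          exact hs0 (Complex.ext (le_antisymm (not_lt.1 hr) hs) him)
    rw [hg]
    fun_prop
  have hgd : ∀ s : ℂ, 0 < s.re → DifferentiableAt ℂ g s := by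
    intro s hs
    have hp : DifferentiableAt ℂ (fun s : ℂ => s ^ (α : ℂ)) s :=
      DifferentiableAt.cpow_const differentiableAt_id (Or.inl hs)
    rw [hg]
    fun_prop
  have hcl : ∀ u ∈ Icc (0:ℝ) 1, Continuous fun l : ℝ => g (u + l * Complex.I) := by
    intro u hu
    refine continuous_iff_continuousAt.2 fun l => ?_
    exact ContinuousAt.comp (f := fun l : ℝ => (u:ℂ) + l * Complex.I) (hgc _ (by simpa using hu.1)) (by fun_prop)
  have hint : ∀ u ∈ Icc (0:ℝ) 1, Integrable fun l : ℝ => g (u + l * Complex.I) := by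
    intro u hu
    refine ((aux_major α (B * κ) (by linarith) (by positivity)).const_mul (Real.exp (|x| + B * C))).mono'
      (hcl u hu).aestronglyMeasurable (Filter.Eventually.of_forall fun l => ?_)
    refine (hgn u hu l).trans ?_
    have : (1:ℝ) ≤ (1 + |l|) ^ 2 := by nlinarith [abs_nonneg l]
    gcongr
    exact le_mul_of_one_le_left (Real.exp_pos _).le this
  have hlim : ∀ u ∈ Icc (0:ℝ) 1, Filter.Tendsto (fun R : ℝ => ∫ l in (-R)..R, g (u + l * Complex.I)) Filter.atTop
      (nhds (∫ l : ℝ, g (u + l * Complex.I))) := fun u hu =>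
    intervalIntegral_tendsto_integral (hint u hu) Filter.tendsto_neg_atTop_atBot Filter.tendsto_id
  have hdec : Filter.Tendsto (fun R : ℝ => Real.exp (|x| + B * C) * Real.exp (-(B * κ) * |R| ^ α)) Filter.atTop (nhds 0) := by
    rw [← mul_zero (Real.exp (|x| + B * C))]
    refine Filter.Tendsto.const_mul _ ?_
    refine Real.tendsto_exp_atBot.comp ?_
    refine Filter.Tendsto.const_mul_atTop_of_neg (by nlinarith) ?_
    exact (tendsto_rpow_atTop (by linarith)).comp Filter.tendsto_abs_atTop_atTop
  have hhor : ∀ σ : ℝ, |σ| = 1 → Filter.Tendsto (fun R : ℝ => ∫ u in (0:ℝ)..1, g (u + ((σ * R : ℝ):ℂ) * Complex.I))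
      Filter.atTop (nhds 0) := by
    intro σ hσ
    refine squeeze_zero_norm (fun R => ?_) hdec
    have := intervalIntegral.norm_integral_le_of_norm_le_const (a := 0) (b := 1)
      (f := fun u : ℝ => g (u + ((σ * R : ℝ):ℂ) * Complex.I))
      (C := Real.exp (|x| + B * C) * Real.exp (-(B * κ) * |R| ^ α)) ?_
    · simpa using this
    · intro u hu
      rw [uIoc_of_le zero_le_one] at hu
      have := hgn u ⟨hu.1.le, hu.2⟩ (σ * R)
      rwa [abs_mul, hσ, one_mul] at this
  have hrect : ∀ R : ℝ, (((∫ u in (0:ℝ)..1, g (u + (((-1) * R : ℝ):ℂ) * Complex.I)) -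
      ∫ u in (0:ℝ)..1, g (u + ((1 * R : ℝ):ℂ) * Complex.I)) +
      Complex.I • ∫ l in (-R)..R, g ((1:ℝ) + l * Complex.I)) -
      Complex.I • ∫ l in (-R)..R, g ((0:ℝ) + l * Complex.I) = 0 := by
    intro R
    have := Complex.integral_boundary_rect_eq_zero_of_continuousOn_of_differentiableOn g ⟨0, -R⟩ ⟨1, R⟩ ?_ ?_
    · simpa using this
    · intro s hs
      have : s.re ∈ uIcc (0:ℝ) 1 := hs.1
      rw [uIcc_of_le zero_le_one] at this
      exact (hgc s this.1).continuousWithinAt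
    · intro s hs
      have : s.re ∈ Ioo (min (0:ℝ) 1) (max 0 1) := hs.1
      exact (hgd s (by simpa using this.1)).differentiableWithinAt
  have hL := (((hhor (-1) (by simp)).sub (hhor 1 (by simp))).add
    ((hlim 1 (by simp)).const_smul Complex.I)).sub ((hlim 0 (by simp)).const_smul Complex.I)
  simp only [hrect] at hL
  have h0 := tendsto_nhds_unique hL tendsto_const_nhds
  have h1 : (∫ l : ℝ, g ((1:ℝ) + l * Complex.I)) = ∫ l : ℝ, g ((0:ℝ) + l * Complex.I) := by
    have h2 : Complex.I * ((∫ l : ℝ, g ((1:ℝ) + l * Complex.I)) - ∫ l : ℝ, g ((0:ℝ) + l * Complex.I)) = 0 := by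
      rw [← h0]; simp only [smul_eq_mul]; ring
    rcases mul_eq_zero.1 h2 with h3 | h3
    · exact absurd h3 Complex.I_ne_zero
    · exact sub_eq_zero.1 h3
  calc _ = ∫ l : ℝ, g ((0:ℝ) + l * Complex.I) := by simp [hg]
    _ = _ := h1.symm
    _ = _ := by simp [hg, stW]

lemma zol_eq (α B x : ℝ) (hα1 : 1 < α) (hα2 : α < 2) (hB : 0 < B) :
    zolDensity α (2 - α) B x = (1 / (2 * Real.pi)) * (∫ l, stW α 0 B x l).re := by
  unfold zolDensity
  rw [← shift α B x hα1 hα2 hB]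
  congr 3
  ext l
  rw [aux_axis α (by linarith) l]
  congr 2 <;> ring

lemma frac_eq (α B y : ℝ) (hα1 : 1 < α) (hα2 : α < 2) (hB : 0 < B) :
    ∫ z in Ioi y, zolDensity α (2 - α) B z * (z - y) ^ (1 - α) =
      Real.Gamma (2 - α) * ((1 / (2 * Real.pi)) * (∫ l, stW α (α - 2) B y l).re) := by
  have hsub : ∫ z in Ioi y, zolDensity α (2 - α) B z * (z - y) ^ (1 - α) =
      ∫ u in Ioi (0:ℝ), zolDensity α (2 - α) B (u + y) * u ^ (1 - α) := by
    have := (measurePreserving_add_right volume y).setIntegral_preimage_emb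
      (measurableEmbedding_addRight y) (fun z => zolDensity α (2 - α) B z * (z - y) ^ (1 - α)) (Ioi y)
    rw [← this]
    simp
  -- product integrability
  have hprod : Integrable (Function.uncurry fun (u l : ℝ) => ((u ^ (1 - α) : ℝ) : ℂ) * stW α 0 B (u + y) l)
      ((volume.restrict (Ioi 0)).prod volume) := by
    have hm := (aux_int_gamma (1 - α) 1 (by linarith) one_pos).integrable.mul_prod
      (int_stW α 0 B y hα1 hα2 (by norm_num) hB).norm
    refine hm.mono' ?_ ?_
    · apply Measurable.aestronglyMeasurable
      have h1 := (cont_cpow1 α).measurable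
      have h2 := (cont_cpow1 0).measurable
      unfold stW
      have h1' : Measurable fun p : ℝ × ℝ => (1 + (p.2:ℂ) * Complex.I) ^ (α : ℂ) := h1.comp measurable_snd
      have h2' : Measurable fun p : ℝ × ℝ => (1 + (p.2:ℂ) * Complex.I) ^ ((0:ℝ) : ℂ) := h2.comp measurable_snd
      simp only [Function.uncurry_def]
      fun_prop
    · have : ∀ᵐ p : ℝ × ℝ ∂((volume.restrict (Ioi (0:ℝ))).prod volume), p.1 ∈ Ioi (0:ℝ) :=
        Measure.quasiMeasurePreserving_fst.ae (ae_restrict_mem measurableSet_Ioi)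
      filter_upwards [this] with p hp
      have hp' : 0 < p.1 := hp
      simp only [Function.uncurry_def, stW, norm_mul, Complex.norm_exp, Complex.norm_real]
      rw [Real.norm_of_nonneg (by positivity)]
      have e1 : (-((1 + (p.2:ℂ) * Complex.I) * ((p.1 + y : ℝ):ℂ))).re = -p.1 + -y := by simp; ring
      have e2 : (-((1 + (p.2:ℂ) * Complex.I) * (y:ℂ))).re = -y := by simp
      rw [e1, e2, Real.exp_add]
      apply le_of_eq
      ring_nf
  have hswap := integral_integral_swap hprod
  have hl : ∀ l : ℝ, ∫ u in Ioi (0:ℝ), ((u ^ (1 - α) : ℝ) : ℂ) * stW α 0 B (u + y) l =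
      (Real.Gamma (2 - α) : ℂ) * stW α (α - 2) B y l := by
    intro l
    have hG := aux_gamma (1 - α) (by linarith) (1 + (l:ℂ) * Complex.I) (by simp)
    have e : ∀ u : ℝ, ((u ^ (1 - α) : ℝ) : ℂ) * stW α 0 B (u + y) l =
        (((u ^ (1 - α) : ℝ) : ℂ) * Complex.exp (-((1 + (l:ℂ) * Complex.I) * u))) * stW α 0 B y l := by
      intro u
      unfold stW
      rw [Complex.ofReal_add, mul_add, neg_add, Complex.exp_add]
      ring
    simp_rw [e]
    rw [integral_mul_const, hG]
    unfold stW
    rw [show 1 - α + 1 = 2 - α by ring, show -(2 - α) = α - 2 by ring]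
    simp; ring
  have hu : ∀ u : ℝ, zolDensity α (2 - α) B (u + y) * u ^ (1 - α) =
      (1 / (2 * Real.pi)) * (∫ l, ((u ^ (1 - α) : ℝ) : ℂ) * stW α 0 B (u + y) l).re := by
    intro u
    rw [zol_eq α B _ hα1 hα2 hB, integral_const_mul, Complex.re_ofReal_mul]
    ring
  rw [hsub]
  simp_rw [hu]
  rw [integral_const_mul]
  have hre := integral_re (𝕜 := ℂ) hprod.integral_prod_left
  simp only [Function.uncurry_apply_pair, RCLike.re_eq_complex_re] at hre
  rw [hre, hswap]
  simp_rw [hl]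
  rw [integral_const_mul, Complex.re_ofReal_mul]
  ring

/-- Space-fractional governing equation for a spectrally negative stable density. -/
theorem space_fractional_governing (α b : ℝ) (hα1 : 1 < α) (hα2 : α < 2) (hb : 0 < b)
    (P : ℝ → ℝ → ℝ) (hP : ∀ x t, P x t = zolDensity α (2 - α) (b ^ (-α) * t) x) :
    ∀ (x t : ℝ), 0 < t →
      deriv (fun s => P x s) t =
        b ^ (-α) * deriv (deriv (fun y => (1 / Real.Gamma (2 - α)) *
            ∫ z in Set.Ioi y, P z t * (z - y) ^ (1 - α))) x := by
  intro x t ht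
  have hbα : 0 < b ^ (-α) := by positivity
  have hB : 0 < b ^ (-α) * t := by positivity
  have hΓ : Real.Gamma (2 - α) ≠ 0 := (Real.Gamma_pos_of_pos (by linarith)).ne'
  have reD : ∀ {f : ℝ → ℂ} {f' : ℂ} {z : ℝ}, HasDerivAt f f' z → HasDerivAt (fun y => (f y).re) f'.re z := by
    intro f f' z h
    exact Complex.reCLM.hasFDerivAt.comp_hasDerivAt z h
  -- left side
  have hL : HasDerivAt (fun s => P x s)
      ((1 / (2 * Real.pi)) * ((∫ l, stW α α (b ^ (-α) * t) x l).re * (b ^ (-α) * 1))) t := by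
    have h1 := reD (deriv_B α (b ^ (-α) * t) x hα1 hα2 hB)
    have h2 : HasDerivAt (fun s : ℝ => b ^ (-α) * s) (b ^ (-α) * 1) t := (hasDerivAt_id t).const_mul _
    have h3 := (HasDerivAt.comp t h1 h2).const_mul (1 / (2 * Real.pi))
    refine h3.congr_of_eventuallyEq ?_
    filter_upwards [lt_mem_nhds ht] with s hs
    rw [hP, zol_eq α _ _ hα1 hα2 (by positivity)]
    rfl
  have hR0 : (fun y => (1 / Real.Gamma (2 - α)) * ∫ z in Set.Ioi y, P z t * (z - y) ^ (1 - α)) =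
      fun y => (1 / (2 * Real.pi)) * (∫ l, stW α (α - 2) (b ^ (-α) * t) y l).re := by
    ext y
    simp_rw [hP]
    rw [frac_eq α _ y hα1 hα2 hB]
    field_simp
  have hR1 : deriv (fun y => (1 / (2 * Real.pi)) * (∫ l, stW α (α - 2) (b ^ (-α) * t) y l).re) =
      fun y => (1 / (2 * Real.pi)) * (-∫ l, stW α (α - 2 + 1) (b ^ (-α) * t) y l).re := by
    ext y
    exact ((reD (deriv_x α (α - 2) _ y hα1 hα2 (by linarith) hB)).const_mul _).deriv
  have hR2 := ((reD (deriv_x α (α - 2 + 1) (b ^ (-α) * t) x hα1 hα2 (by linarith) hB).neg).const_mul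
    (1 / (2 * Real.pi))).deriv
  rw [hL.deriv, hR0, hR1]
  erw [hR2]
  rw [neg_neg, show α - 2 + 1 + 1 = α by ring]
  ring
end

section
/- Space-fractional equation for the inverse stable subordinator density: Let 1 < α < 2, γ = 1/α, b > 0, let g_γ(x) = p_γ(x; γ, b), and let h(x,t) = (t/γ) x^{−1−1/γ} g_γ(t x^{−1/γ}) for x > 0 be the density of the inverse stable subordinator E_t. Then for all t > 0 and x > 0, (∂h/∂t)(x,t) = b^{−α} · (1/Γ(2−α)) · (d²/dx²) ∫_x^∞ h(y,t)(y−x)^{1−α} dy. -/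
open MeasureTheory Real Set

noncomputable def JJ (α t : ℝ) (k : ℂ) (s u y : ℝ) : ℂ :=
  Complex.exp (-Complex.I * (t:ℂ) * ((u ^ α : ℝ) : ℂ)) * ((u ^ s : ℝ) : ℂ) *
    Complex.exp (-(k * (y:ℂ) * (u:ℂ)))

lemma JJ_norm (α t : ℝ) (k : ℂ) (s u y : ℝ) (hu : 0 < u) :
    ‖JJ α t k s u y‖ = u ^ s * Real.exp (-(k.re * y) * u) := by
  have hs : 0 < u ^ s := rpow_pos_of_pos hu s
  simp only [JJ, norm_mul, Complex.norm_exp, Complex.norm_real, Real.norm_eq_abs, abs_of_pos hs]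
  simp

lemma JJ_meas (α t : ℝ) (k : ℂ) (s y : ℝ) : Measurable (fun u => JJ α t k s u y) := by
  unfold JJ
  fun_prop

lemma base_int (s r : ℝ) (hs : -1 < s) (hr : 0 < r) :
    IntegrableOn (fun u : ℝ => u ^ s * Real.exp (-r * u)) (Ioi 0) := by
  have := integrableOn_rpow_mul_exp_neg_mul_rpow (s := s) (p := 1) hs one_pos hr
  simpa using this

lemma JJ_int (α t : ℝ) (k : ℂ) (s y : ℝ) (hs : -1 < s) (hk : 0 < k.re) (hy : 0 < y) :
    IntegrableOn (fun u => JJ α t k s u y) (Ioi 0) := by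
  refine Integrable.mono' (base_int s (k.re * y) hs (by positivity))
    (JJ_meas α t k s y).aestronglyMeasurable ?_
  refine (ae_restrict_iff' measurableSet_Ioi).2 (.of_forall fun u hu => ?_)
  rw [JJ_norm _ _ _ _ _ _ hu]

noncomputable def J (α t : ℝ) (k : ℂ) (s y : ℝ) : ℂ := ∫ u in Ioi (0:ℝ), JJ α t k s u y

lemma J_deriv_y (α t : ℝ) (k : ℂ) (s y : ℝ) (hs : -1 < s) (hk : 0 < k.re) (hy : 0 < y) :
    HasDerivAt (fun y => J α t k s y) (-k * J α t k (s+1) y) y := by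
  have key := hasDerivAt_integral_of_dominated_loc_of_deriv_le (μ := volume.restrict (Ioi (0:ℝ)))
    (F := fun y u => JJ α t k s u y) (F' := fun y u => -k * JJ α t k (s+1) u y)
    (x₀ := y) (s := Ioi (y/2)) (bound := fun u => ‖k‖ * (u ^ (s+1) * Real.exp (-(k.re * (y/2)) * u)))
    (Ioi_mem_nhds (by linarith))
    (.of_forall fun x => (JJ_meas α t k s x).aestronglyMeasurable)
    (JJ_int α t k s y hs hk hy)
    ((measurable_const.mul (JJ_meas α t k (s+1) y)).aestronglyMeasurable) ?_ ?_ ?_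
  · have := key.2
    rw [integral_const_mul] at this
    exact this
  · refine (ae_restrict_iff' measurableSet_Ioi).2 (.of_forall fun u hu x hx => ?_)
    rw [norm_mul, norm_neg, JJ_norm _ _ _ _ _ _ hu]
    have hu' : 0 < u := hu
    have hx' : y / 2 < x := hx
    gcongr
  · exact (base_int (s+1) _ (by linarith) (by positivity)).const_mul _
  · refine (ae_restrict_iff' measurableSet_Ioi).2 (.of_forall fun u hu x hx => ?_)
    have hu' : 0 < u := hu
    unfold JJ
    have h1 : HasDerivAt (fun x : ℝ => (x:ℂ)) 1 x := Complex.ofRealCLM.hasDerivAt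
    have h2 := (((h1.const_mul k).mul_const (u:ℂ)).neg.cexp).const_mul
      (Complex.exp (-Complex.I * (t:ℂ) * ((u ^ α : ℝ) : ℂ)) * ((u ^ s : ℝ) : ℂ))
    refine h2.congr_deriv ?_
    simp only [Pi.neg_apply]
    rw [Real.rpow_add_one hu'.ne']
    push_cast
    ring

lemma J_deriv_t (α t : ℝ) (k : ℂ) (s y : ℝ) (hα : 0 < α) (hs : -1 < s) (hk : 0 < k.re) (hy : 0 < y) :
    HasDerivAt (fun t => J α t k s y) (-Complex.I * J α t k (s+α) y) t := by
  have key := hasDerivAt_integral_of_dominated_loc_of_deriv_le (μ := volume.restrict (Ioi (0:ℝ)))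
    (F := fun t u => JJ α t k s u y) (F' := fun t u => -Complex.I * JJ α t k (s+α) u y)
    (x₀ := t) (s := univ) (bound := fun u => (u ^ (s+α) * Real.exp (-(k.re * y) * u)))
    Filter.univ_mem
    (.of_forall fun x => (JJ_meas α x k s y).aestronglyMeasurable)
    (JJ_int α t k s y hs hk hy)
    ((measurable_const.mul (JJ_meas α t k (s+α) y)).aestronglyMeasurable) ?_ ?_ ?_
  · have := key.2
    rw [integral_const_mul] at this
    exact this
  · refine (ae_restrict_iff' measurableSet_Ioi).2 (.of_forall fun u hu x hx => ?_)
    rw [norm_mul, norm_neg, JJ_norm _ _ _ _ _ _ hu]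
    simp
  · exact (base_int (s+α) _ (by linarith) (by positivity))
  · refine (ae_restrict_iff' measurableSet_Ioi).2 (.of_forall fun u hu x hx => ?_)
    have hu' : 0 < u := hu
    unfold JJ
    have h1 : HasDerivAt (fun x : ℝ => (x:ℂ)) 1 x := Complex.ofRealCLM.hasDerivAt
    have h2 := ((((h1.const_mul (-Complex.I)).mul_const ((u ^ α : ℝ) : ℂ)).cexp).mul_const
      ((u ^ s : ℝ) : ℂ)).mul_const (Complex.exp (-(k * (y:ℂ) * (u:ℂ))))
    refine h2.congr_deriv ?_
    rw [Real.rpow_add hu']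
    push_cast
    ring

/-- integration by parts -/
lemma J_parts (α t : ℝ) (k : ℂ) (y : ℝ) (hα : 1 < α) (hk : 0 < k.re) (hy : 0 < y) :
    (t:ℂ) * α * J α t k (α - 1) y = -Complex.I + Complex.I * k * y * J α t k 0 y := by
  have h := integral_Ioi_of_hasDerivAt_of_tendsto (a := (0:ℝ)) (m := (0:ℂ))
    (f := fun u => JJ α t k 0 u y)
    (f' := fun u => (-Complex.I * t * α) * JJ α t k (α-1) u y + (-(k*y)) * JJ α t k 0 u y) ?_ ?_ ?_ ?_
  · rw [integral_add ((JJ_int α t k (α-1) y (by linarith) hk hy).const_mul _)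
      ((JJ_int α t k 0 y (by linarith) hk hy).const_mul _), integral_const_mul, integral_const_mul] at h
    change _ * J α t k (α-1) y + _ * J α t k 0 y = _ at h
    have h0 : JJ α t k 0 0 y = 1 := by
      simp [JJ, Real.zero_rpow (by linarith : α ≠ 0)]
    rw [h0] at h
    linear_combination Complex.I * h + (t * α * J α t k (α-1) y) * Complex.I_sq
  · apply Continuous.continuousWithinAt
    unfold JJ
    have : Continuous fun u : ℝ => u ^ α := Real.continuous_rpow_const (by linarith)
    simp only [Real.rpow_zero]
    fun_prop
  · intro u hu
    have hu' : 0 < u := hu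
    unfold JJ
    simp only [Real.rpow_zero]
    have h1 : HasDerivAt (fun x : ℝ => (x:ℂ)) 1 u := Complex.ofRealCLM.hasDerivAt
    have h3 := (Real.hasDerivAt_rpow_const (x := u) (p := α) (Or.inl hu'.ne')).ofReal_comp
    have h2 := (((h3.const_mul (-Complex.I * (t:ℂ))).cexp).mul_const ((1:ℝ):ℂ)).mul
      ((h1.const_mul (k * y)).neg.cexp)
    refine h2.congr_deriv ?_
    simp only [Pi.neg_apply]
    push_cast
    ring
  · exact ((JJ_int α t k (α-1) y (by linarith) hk hy).const_mul _).add
      ((JJ_int α t k 0 y (by linarith) hk hy).const_mul _)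
  · rw [tendsto_zero_iff_norm_tendsto_zero]
    have : Filter.Tendsto (fun u : ℝ => Real.exp (-(k.re*y) * u)) Filter.atTop (nhds 0) := by
      apply Real.tendsto_exp_atBot.comp
      exact Filter.tendsto_id.const_mul_atTop_of_neg (by nlinarith [mul_pos hk hy])
    refine this.congr' ?_
    filter_upwards [Filter.eventually_gt_atTop 0] with u hu
    rw [JJ_norm _ _ _ _ _ _ hu]; simp

/-- the density as half-line integral -/
lemma zol_half (γ b x : ℝ) (hγ0 : 0 < γ) (hγ : γ < 1) (hb : 0 < b) :
    zolDensity γ γ b x = (1 / π) * (∫ l in Ioi (0:ℝ),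
      Complex.exp (-Complex.I * (l : ℂ) * (x : ℂ)) *
        Complex.exp (-((b : ℂ) * Complex.exp (-Complex.I * π * γ / 2)) * ((l ^ γ : ℝ) : ℂ))).re := by
  set c : ℂ := Complex.exp (-Complex.I * π * γ / 2) with hc
  have hcre : 0 < c.re := by
    have : c = Complex.exp (((-(π * γ / 2) : ℝ) : ℂ) * Complex.I) := by
      rw [hc]; congr 1; push_cast; ring
    rw [this, Complex.exp_ofReal_mul_I_re]
    apply Real.cos_pos_of_mem_Ioo
    constructor <;> nlinarith [Real.pi_pos]
  set F : ℝ → ℂ := fun l => Complex.exp (-Complex.I * (l : ℂ) * (x : ℂ)) *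
        Complex.exp (-(b : ℂ) * ((|l| ^ γ : ℝ) : ℂ) *
          Complex.exp (-Complex.I * (Real.pi : ℂ) * (γ : ℂ) * ((Real.sign l : ℝ) : ℂ) / 2)) with hF
  set P : ℝ → ℂ := fun l => Complex.exp (-Complex.I * (l : ℂ) * (x : ℂ)) *
        Complex.exp (-((b : ℂ) * c) * ((l ^ γ : ℝ) : ℂ)) with hP
  have hpos : ∀ l ∈ Ioi (0:ℝ), F l = P l := by
    intro l hl
    have hl' : 0 < l := hl
    simp only [hF, hP, abs_of_pos hl', Real.sign_of_pos hl', hc]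
    congr 2
    push_cast
    ring_nf
  have hneg : ∀ l ∈ Ioi (0:ℝ), F (-l) = (starRingEnd ℂ) (P l) := by
    intro l hl
    have hl' : 0 < l := hl
    simp only [hF, hP, abs_neg, abs_of_pos hl', Real.sign_of_neg (neg_lt_zero.2 hl'), hc, map_mul,
      ← Complex.exp_conj, map_neg, Complex.conj_ofReal, Complex.conj_I, map_div₀]
    congr 2
    · push_cast; ring
    · push_cast
      have : (starRingEnd ℂ) 2 = 2 := Complex.conj_ofReal 2
      rw [this]
      ring_nf
  have hPint : IntegrableOn P (Ioi 0) := by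
    have := integrableOn_rpow_mul_exp_neg_mul_rpow (s := 0) (p := γ) (b := b * c.re) (by norm_num) hγ0 (by positivity)
    refine Integrable.mono' this ?_ ?_
    · apply Measurable.aestronglyMeasurable
      simp only [hP]
      fun_prop
    · refine (ae_restrict_iff' measurableSet_Ioi).2 (.of_forall fun u hu => ?_)
      simp only [hP, norm_mul, Complex.norm_exp]
      simp
  have hF1 : IntegrableOn F (Ioi 0) :=
    hPint.congr_fun (fun l hl => (hpos l hl).symm) measurableSet_Ioi
  have hPc : IntegrableOn (fun l => (starRingEnd ℂ) (P l)) (Ioi 0) := 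
    Complex.conjCLE.toContinuousLinearMap.integrable_comp hPint
  have hF2 : IntegrableOn F (Iic 0) := by
    have h1 : IntegrableOn (fun l => F (-l)) (Ioi 0) :=
      hPc.congr_fun (fun l hl => (hneg l hl).symm) measurableSet_Ioi
    have := h1.comp_neg
    simp only [neg_neg] at this
    rw [integrableOn_Iic_iff_integrableOn_Iio]
    simpa using this
  have hsplit : ∫ l, F l = (∫ l in Ioi (0:ℝ), P l) + (starRingEnd ℂ) (∫ l in Ioi (0:ℝ), P l) := by
    rw [← intervalIntegral.integral_Iic_add_Ioi hF2 hF1, add_comm]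
    congr 1
    · exact setIntegral_congr_fun measurableSet_Ioi hpos
    · rw [← neg_zero, ← integral_comp_neg_Ioi, setIntegral_congr_fun measurableSet_Ioi hneg, integral_conj]
      simp
  unfold zolDensity
  rw [hsplit]
  simp only [Complex.add_re, Complex.conj_re]
  field_simp
  ring

lemma zol_J (α b t y : ℝ) (hα1 : 1 < α) (hb : 0 < b) (hy : 0 < y) :
    zolDensity (1/α) (1/α) b (t * y ^ (-α)) = (α * y ^ α / π) *
      (J α t ((b : ℂ) * Complex.exp (-Complex.I * π * ((1/α : ℝ):ℂ) / 2)) (α - 1) y).re := by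
  have hα0 : 0 < α := by linarith
  rw [zol_half _ _ _ (by positivity) (by rw [div_lt_one hα0]; exact hα1) hb]
  set k : ℂ := (b : ℂ) * Complex.exp (-Complex.I * π * ((1/α : ℝ):ℂ) / 2)
  rw [← integral_comp_rpow_Ioi_of_pos hα0]
  have h := integral_comp_mul_left_Ioi' (fun u : ℝ => (α * u ^ (α - 1)) •
    (Complex.exp (-Complex.I * ((u ^ α : ℝ) : ℂ) * ((t * y ^ (-α) : ℝ) : ℂ)) *
        Complex.exp (-k * (((u ^ α) ^ (1/α) : ℝ) : ℂ)))) 0 hy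
  rw [mul_zero] at h
  rw [← h]
  have h2 : ∀ u ∈ Ioi (0:ℝ), (fun u : ℝ => (α * (y * u) ^ (α - 1)) •
    (Complex.exp (-Complex.I * (((y * u) ^ α : ℝ) : ℂ) * ((t * y ^ (-α) : ℝ) : ℂ)) *
        Complex.exp (-k * ((((y * u) ^ α) ^ (1/α) : ℝ) : ℂ)))) u
      = (fun u => (α * y ^ (α-1)) • JJ α t k (α - 1) u y) u := by
    intro u hu
    have hu' : 0 < u := hu
    simp only [JJ]
    rw [← Real.rpow_mul (by positivity), mul_one_div_cancel hα0.ne', Real.rpow_one,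
      Real.mul_rpow hy.le hu'.le, Real.mul_rpow hy.le hu'.le]
    have e1 : -Complex.I * ((y ^ α * u ^ α : ℝ) : ℂ) * ((t * y ^ (-α) : ℝ) : ℂ)
       = -Complex.I * (t:ℂ) * ((u ^ α : ℝ) : ℂ) := by
      have : y ^ α * y ^ (-α) = 1 := by
        rw [← Real.rpow_add hy]; simp
      have h' : ((y ^ α : ℝ) : ℂ) * ((y ^ (-α) : ℝ) : ℂ) = 1 := by exact_mod_cast this
      push_cast
      linear_combination (-Complex.I * ((u ^ α : ℝ) : ℂ) * t) * h'
    rw [e1]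
    simp only [Complex.real_smul]
    push_cast
    ring_nf
  rw [setIntegral_congr_fun measurableSet_Ioi h2]
  rw [integral_smul]
  change _ * (y • (α * y ^ (α-1)) • J α t k (α-1) y).re = _
  rw [Complex.smul_re, Complex.smul_re, Real.rpow_sub_one hy.ne']
  simp only [smul_eq_mul]
  field_simp

lemma h_J (α b t y : ℝ) (hα1 : 1 < α) (hb : 0 < b) (hy : 0 < y) (c k : ℂ)
    (hc : c = Complex.exp (-Complex.I * π * ((1/α : ℝ):ℂ) / 2)) (hk : k = b * c) (hkre : 0 < k.re) :
    (t * α) * y ^ (-1 - α) * zolDensity (1/α) (1/α) b (t * y ^ (-α)) =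
      (α * b / π) * (Complex.I * c * J α t k 0 y).re := by
  rw [zol_J α b t y hα1 hb hy, ← hc, ← hk]
  have h := congrArg Complex.re (J_parts α t k y hα1 hkre hy)
  have e1 : (t:ℂ) * α * J α t k (α - 1) y = ((t * α : ℝ) : ℂ) * J α t k (α - 1) y := by push_cast; ring
  have e2 : Complex.I * k * y * J α t k 0 y = ((b * y : ℝ) : ℂ) * (Complex.I * c * J α t k 0 y) := by
    rw [hk]; push_cast; ring
  rw [e1, e2, Complex.add_re, Complex.re_ofReal_mul, Complex.re_ofReal_mul] at h
  simp only [Complex.neg_re, Complex.I_re, neg_zero, zero_add] at h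
  have e3 : y ^ (-1 - α) * y ^ α = y⁻¹ := by
    rw [← Real.rpow_add hy, ← Real.rpow_neg_one]; congr 1; ring
  calc _ = (y ^ (-1 - α) * y ^ α) * (α / π) * (t * α * (J α t k (α - 1) y).re) := by ring
    _ = _ := by rw [e3, h]; field_simp

lemma gamma_int_integrable (a : ℝ) (ha : 0 < a) (k : ℂ) (hk : 0 < k.re) :
    IntegrableOn (fun v : ℝ => ((v ^ (a-1) : ℝ) : ℂ) * Complex.exp (-(k * v))) (Ioi 0) := by
  refine Integrable.mono' (base_int (a-1) k.re (by linarith) hk) ?_ ?_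
  · apply Measurable.aestronglyMeasurable
    fun_prop
  · refine (ae_restrict_iff' measurableSet_Ioi).2 (.of_forall fun u hu => ?_)
    have hu' : 0 < u := hu
    have := rpow_pos_of_pos hu' (a-1)
    simp only [norm_mul, Complex.norm_exp, Complex.norm_real, Real.norm_eq_abs, abs_of_pos this]
    simp

lemma gamma_int (a : ℝ) (ha : 0 < a) (k : ℂ) (hk : 0 < k.re) :
    ∫ v in Ioi (0:ℝ), ((v ^ (a-1) : ℝ) : ℂ) * Complex.exp (-(k * v)) =
      (1 / k) ^ (a : ℂ) * (Real.Gamma a : ℂ) := by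
  set G : ℂ → ℂ := fun k => ∫ v in Ioi (0:ℝ), ((v ^ (a-1) : ℝ) : ℂ) * Complex.exp (-(k * v)) with hG
  set U : Set ℂ := {z | 0 < z.re} with hU
  have hUo : IsOpen U := isOpen_lt continuous_const Complex.continuous_re
  have hUc : IsPreconnected U := (convex_halfSpace_re_gt 0).isPreconnected
  have hGd : DifferentiableOn ℂ G U := by
    intro k hk
    have hk' : 0 < k.re := hk
    refine DifferentiableAt.differentiableWithinAt ?_
    have key := hasDerivAt_integral_of_dominated_loc_of_deriv_le (μ := volume.restrict (Ioi (0:ℝ)))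
      (F := fun k v => ((v ^ (a-1) : ℝ) : ℂ) * Complex.exp (-(k * (v:ℂ))))
      (F' := fun k v => -(((v ^ (a+1-1) : ℝ) : ℂ) * Complex.exp (-(k * (v:ℂ)))))
      (x₀ := k) (s := {z | k.re/2 < z.re})
      (bound := fun v => (v ^ (a) * Real.exp (-(k.re/2) * v)))
      ((isOpen_lt continuous_const Complex.continuous_re).mem_nhds
        (by simp only [mem_ofPred_eq]; linarith))
      (.of_forall fun x => Measurable.aestronglyMeasurable (by fun_prop))
      (gamma_int_integrable a ha k hk)
      (Measurable.aestronglyMeasurable (by fun_prop)) ?_ ?_ ?_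
    · exact key.2.differentiableAt
    · refine (ae_restrict_iff' measurableSet_Ioi).2 (.of_forall fun u hu x hx => ?_)
      have hu' : 0 < u := hu
      have hx' : k.re / 2 < x.re := hx
      have := rpow_pos_of_pos hu' a
      simp only [norm_neg, norm_mul, Complex.norm_exp, Complex.norm_real, Real.norm_eq_abs,
        add_sub_cancel_right, abs_of_pos this]
      have : (-(x * u)).re = - x.re * u := by simp
      rw [this]
      gcongr
    · exact base_int a _ (by linarith) (by positivity)
    · refine (ae_restrict_iff' measurableSet_Ioi).2 (.of_forall fun u hu x hx => ?_)
      have hu' : 0 < u := hu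
      have h2 := ((((hasDerivAt_id x).mul_const (u:ℂ)).neg).cexp).const_mul ((u ^ (a-1) : ℝ) : ℂ)
      refine h2.congr_deriv ?_
      simp only [Pi.neg_apply, id]
      rw [show a + 1 - 1 = (a - 1) + 1 by ring, Real.rpow_add_one hu'.ne']
      push_cast
      ring
  have hRd : DifferentiableOn ℂ (fun k : ℂ => (1 / k) ^ (a : ℂ) * (Real.Gamma a : ℂ)) U := by
    intro k hk
    have hk' : 0 < k.re := hk
    have hk0 : k ≠ 0 := by rintro rfl; simp at hk'
    refine DifferentiableAt.differentiableWithinAt ?_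
    refine DifferentiableAt.mul_const ?_ _
    refine DifferentiableAt.cpow_const ?_ ?_
    · exact (differentiableAt_const _).div differentiableAt_id hk0
    · left
      rw [one_div, Complex.inv_re]
      exact div_pos hk' (Complex.normSq_pos.2 hk0)
  have hreal : ∀ r : ℝ, 0 < r → G r = (1 / (r:ℂ)) ^ (a : ℂ) * (Real.Gamma a : ℂ) := by
    intro r hr
    have := Complex.integral_cpow_mul_exp_neg_mul_Ioi (a := (a:ℂ)) (r := r) (by simpa using ha) hr
    rw [← Complex.Gamma_ofReal, ← this, hG]
    refine setIntegral_congr_fun measurableSet_Ioi fun v hv => ?_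
    have hv' : 0 < v := hv
    rw [Complex.ofReal_cpow hv'.le]
    push_cast
    rfl
  have hfreq : ∃ᶠ z in nhdsWithin (1:ℂ) {1}ᶜ, G z = (1 / z) ^ (a : ℂ) * (Real.Gamma a : ℂ) := by
    have htend : Filter.Tendsto (fun r : ℝ => (r:ℂ)) (nhdsWithin 1 (Ioi 1)) (nhdsWithin (1:ℂ) {1}ᶜ) := by
      refine tendsto_nhdsWithin_iff.2 ⟨?_, ?_⟩
      · have : Filter.Tendsto (fun r : ℝ => (r:ℂ)) (nhds 1) (nhds ((1:ℝ):ℂ)) :=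
          Complex.continuous_ofReal.tendsto 1
        rw [Complex.ofReal_one] at this
        exact this.mono_left nhdsWithin_le_nhds
      · filter_upwards [self_mem_nhdsWithin] with r hr
        have : (1:ℝ) < r := hr
        simp only [mem_compl_iff, mem_singleton_iff]
        exact_mod_cast this.ne'
    refine htend.frequently (Filter.Eventually.frequently ?_)
    filter_upwards [self_mem_nhdsWithin] with r hr
    exact hreal r (lt_trans one_pos hr)
  exact (hGd.analyticOnNhd hUo).eqOn_of_preconnected_of_frequently_eq (hRd.analyticOnNhd hUo) hUc
    (z₀ := 1) (by simp [hU]) hfreq hk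

noncomputable def KK (α t : ℝ) (k : ℂ) (z v u : ℝ) : ℂ :=
  JJ α t k 0 u (z + v) * ((v ^ (1 - α) : ℝ) : ℂ)

lemma KK_eq (α t : ℝ) (k : ℂ) (z v u : ℝ) :
    KK α t k z v u = JJ α t k 0 u z * (((v ^ ((2 - α) - 1) : ℝ) : ℂ) * Complex.exp (-((k * u) * v))) := by
  unfold KK JJ
  rw [show (2 - α) - 1 = 1 - α by ring]
  have : Complex.exp (-(k * ((z + v : ℝ):ℂ) * u)) = Complex.exp (-(k * z * u)) * Complex.exp (-((k * u) * v)) := by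
    rw [← Complex.exp_add]; congr 1; push_cast; ring
  rw [this]
  ring

lemma KK_inner (α t : ℝ) (k : ℂ) (z u : ℝ) (hα2 : α < 2) (hk : 0 < k.re) (hu : 0 < u) :
    ∫ v in Ioi (0:ℝ), KK α t k z v u =
      ((1 / k) ^ ((2 - α : ℝ) : ℂ) * (Real.Gamma (2 - α) : ℂ)) * JJ α t k (α - 2) u z := by
  simp_rw [KK_eq]
  rw [integral_const_mul, gamma_int (2 - α) (by linarith) (k * u) (by simpa using mul_pos hk hu)]
  have e : (1 / (k * u)) ^ ((2 - α : ℝ) : ℂ) = ((u ^ (α - 2) : ℝ) : ℂ) * (1 / k) ^ ((2 - α : ℝ) : ℂ) := by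
    rw [show (1 / (k * u)) = (((1 / u : ℝ)) : ℂ) * (1 / k) by push_cast; rw [div_mul_div_comm, one_mul, mul_comm k]]
    have hk0 : k ≠ 0 := by rintro rfl; simp at hk
    have hu1 : (0:ℝ) < 1 / u := by positivity
    have hu2 : (((1 / u : ℝ)) : ℂ) ≠ 0 := by exact_mod_cast hu1.ne'
    rw [Complex.cpow_def_of_ne_zero (mul_ne_zero hu2 (one_div_ne_zero hk0)),
      Complex.cpow_def_of_ne_zero (one_div_ne_zero hk0),
      Complex.log_ofReal_mul hu1 (one_div_ne_zero hk0), Real.rpow_def_of_pos hu, Complex.ofReal_exp,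
      ← Complex.exp_add, one_div u, Real.log_inv]
    congr 1
    push_cast
    ring
  rw [e]
  unfold JJ
  simp only [Real.rpow_zero]
  push_cast
  ring

lemma KK_int (α t : ℝ) (k : ℂ) (z : ℝ) (hα1 : 1 < α) (hα2 : α < 2) (hk : 0 < k.re) (hz : 0 < z) :
    Integrable (Function.uncurry (KK α t k z))
      ((volume.restrict (Ioi (0:ℝ))).prod (volume.restrict (Ioi (0:ℝ)))) := by
  rw [integrable_prod_iff']
  swap
  · apply Measurable.aestronglyMeasurable
    unfold KK JJ Function.uncurry
    fun_prop
  have hnorm : ∀ u ∈ Ioi (0:ℝ), ∀ v ∈ Ioi (0:ℝ), ‖KK α t k z v u‖ =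
      Real.exp (-(k.re * z) * u) * (v ^ ((2 - α) - 1) * Real.exp (-((k.re * u) * v))) := by
    intro u hu v hv
    have hv' : 0 < v := hv
    have := rpow_pos_of_pos hv' (2 - α - 1)
    rw [KK_eq, norm_mul, JJ_norm _ _ _ _ _ _ hu]
    simp only [norm_mul, Complex.norm_exp, Complex.norm_real, Real.norm_eq_abs, abs_of_pos this]
    simp
  constructor
  · refine (ae_restrict_iff' measurableSet_Ioi).2 (.of_forall fun u hu => ?_)
    have hu' : 0 < u := hu
    simp only [Function.uncurry, KK_eq]
    exact (gamma_int_integrable (2 - α) (by linarith) (k * u) (by simpa using mul_pos hk hu')).const_mul _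
  · have hI : IntegrableOn (fun u : ℝ => ((1 / k.re) ^ (2 - α) * Real.Gamma (2 - α)) *
        (u ^ (α - 2) * Real.exp (-(k.re * z) * u))) (Ioi 0) :=
      (base_int (α - 2) _ (by linarith) (by positivity)).const_mul _
    refine hI.congr_fun (fun u hu => ?_) measurableSet_Ioi
    have hu' : 0 < u := hu
    simp only [Function.uncurry]
    rw [setIntegral_congr_fun measurableSet_Ioi (hnorm u hu), integral_const_mul,
      Real.integral_rpow_mul_exp_neg_mul_Ioi (by linarith) (by positivity)]
    have e : (1 / (k.re * u)) ^ (2 - α) = (1 / k.re) ^ (2 - α) * u ^ (α - 2) := by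
      rw [← one_div_mul_one_div, Real.mul_rpow (by positivity) (by positivity), one_div u,
        Real.inv_rpow hu'.le, ← Real.rpow_neg hu'.le]
      congr 2; ring
    rw [e]
    ring

lemma J_frac (α t : ℝ) (k : ℂ) (z : ℝ) (hα1 : 1 < α) (hα2 : α < 2) (hk : 0 < k.re) (hz : 0 < z) :
    ∫ v in Ioi (0:ℝ), J α t k 0 (z + v) * ((v ^ (1 - α) : ℝ) : ℂ) =
      ((1 / k) ^ ((2 - α : ℝ) : ℂ) * (Real.Gamma (2 - α) : ℂ)) * J α t k (α - 2) z := by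
  have h1 : ∀ v : ℝ, J α t k 0 (z + v) * ((v ^ (1 - α) : ℝ) : ℂ) = ∫ u in Ioi (0:ℝ), KK α t k z v u := by
    intro v
    unfold KK J
    rw [integral_mul_const]
  simp_rw [h1]
  rw [integral_integral_swap (KK_int α t k z hα1 hα2 hk hz)]
  rw [setIntegral_congr_fun measurableSet_Ioi (fun u hu => KK_inner α t k z u hα2 hk hu),
    integral_const_mul]
  rfl

lemma J_frac_int (α t : ℝ) (k : ℂ) (z : ℝ) (hα1 : 1 < α) (hα2 : α < 2) (hk : 0 < k.re) (hz : 0 < z) :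
    IntegrableOn (fun v : ℝ => J α t k 0 (z + v) * ((v ^ (1 - α) : ℝ) : ℂ)) (Ioi 0) := by
  have h1 : ∀ v : ℝ, J α t k 0 (z + v) * ((v ^ (1 - α) : ℝ) : ℂ) = ∫ u in Ioi (0:ℝ), KK α t k z v u := by
    intro v
    unfold KK J
    rw [integral_mul_const]
  simp_rw [h1]
  exact (KK_int α t k z hα1 hα2 hk hz).integral_prod_left

theorem space_fractional_inverse_subordinator (α b : ℝ) (hα1 : 1 < α) (hα2 : α < 2)
    (hb : 0 < b) (γ : ℝ) (hγ : γ = 1 / α)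
    (g : ℝ → ℝ) (hg : ∀ x, g x = zolDensity γ γ b x)
    (h : ℝ → ℝ → ℝ)
    (hh : ∀ x t, h x t = (t / γ) * x ^ (-1 - 1 / γ) * g (t * x ^ (-(1 / γ)))) :
    ∀ t x : ℝ, 0 < t → 0 < x →
      deriv (fun s => h x s) t =
        b ^ (-α) * deriv (deriv (fun z => (1 / Real.Gamma (2 - α)) *
            ∫ y in Set.Ioi z, h y t * (y - z) ^ (1 - α))) x := by
  intro t x ht hx
  have hα0 : 0 < α := by linarith
  obtain ⟨c, hc⟩ : ∃ c : ℂ, c = Complex.exp (-Complex.I * π * ((1/α : ℝ):ℂ) / 2) := ⟨_, rfl⟩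
  obtain ⟨k, hk⟩ : ∃ k : ℂ, k = b * c := ⟨_, rfl⟩
  have hα' : 1 / α < 1 := by rw [div_lt_one hα0]; exact hα1
  have hα'' : 0 < 1 / α := by positivity
  have hc2 : c = Complex.exp (((-(π * (1/α) / 2) : ℝ) : ℂ) * Complex.I) := by
    rw [hc]; congr 1; push_cast; ring
  have hcre : 0 < c.re := by
    rw [hc2, Complex.exp_ofReal_mul_I_re]
    apply Real.cos_pos_of_mem_Ioo
    constructor <;> nlinarith [Real.pi_pos]
  have hkre : 0 < k.re := by rw [hk, Complex.re_ofReal_mul]; positivity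
  have hk0 : k ≠ 0 := by rintro rfl; simp at hkre
  -- the algebraic constant
  have hconst : (1 / k) ^ ((2 - α : ℝ) : ℂ) * k ^ 2 = ((b ^ α : ℝ) : ℂ) * (-Complex.I) := by
    have hb' : (b:ℂ) = Complex.exp ((Real.log b : ℝ) : ℂ) := by
      rw [← Complex.ofReal_exp, Real.exp_log hb]
    have hkexp : k = Complex.exp ((Real.log b : ℝ) + ((-(π * (1/α) / 2) : ℝ) : ℂ) * Complex.I) := by
      rw [Complex.exp_add, ← hb', ← hc2, hk]
    have hlog : Complex.log (1 / k) = -((Real.log b : ℝ) + ((-(π * (1/α) / 2) : ℝ) : ℂ) * Complex.I) := by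
      rw [one_div, hkexp, ← Complex.exp_neg, Complex.log_exp]
      · have : (-((Real.log b : ℝ) + ((-(π * (1/α) / 2) : ℝ) : ℂ) * Complex.I)).im = π * (1/α) / 2 := by
          simp
        rw [this]; nlinarith [Real.pi_pos]
      · have : (-((Real.log b : ℝ) + ((-(π * (1/α) / 2) : ℝ) : ℂ) * Complex.I)).im = π * (1/α) / 2 := by
          simp
        rw [this]; nlinarith [Real.pi_pos]
    rw [Complex.cpow_def_of_ne_zero (one_div_ne_zero hk0), hlog, sq]
    nth_rewrite 1 [hkexp]
    nth_rewrite 1 [hkexp]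
    rw [← Complex.exp_add, ← Complex.exp_add, Real.rpow_def_of_pos hb, Complex.ofReal_exp,
      ← Complex.exp_neg_pi_div_two_mul_I, ← Complex.exp_add]
    congr 1
    have hαc : (α:ℂ) ≠ 0 := by exact_mod_cast hα0.ne'
    push_cast
    field_simp
    ring
  have hJ : ∀ y s : ℝ, 0 < y → h y s = (α * b / π) * (Complex.I * c * J α s k 0 y).re := by
    intro y s hy
    rw [← h_J α b s y hα1 hb hy c k hc hk hkre, hh, hg, hγ, one_div_one_div, div_div_eq_mul_div, div_one]
  -- derivative in time
  have hL : HasDerivAt (fun s => h x s)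
      ((α * b / π) * (Complex.I * c * (-Complex.I * J α t k (0 + α) x)).re) t := by
    have h1 := ((J_deriv_t α t k 0 x hα0 (by norm_num) hkre hx).const_mul (Complex.I * c))
    have h2 := (Complex.reCLM.hasFDerivAt.comp_hasDerivAt t h1).const_mul (α * b / π)
    have h3 : (fun s => h x s) = fun s => (α * b / π) * (Complex.I * c * J α s k 0 x).re := by
      funext s; exact hJ x s hx
    rw [h3]
    exact h2
  -- the fractional integral
  set D : ℂ := Complex.I * c * (1 / k) ^ ((2 - α : ℝ) : ℂ) with hD
  have hGpos : 0 < Real.Gamma (2 - α) := Real.Gamma_pos_of_pos (by linarith)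
  have hI : ∀ z : ℝ, 0 < z → (1 / Real.Gamma (2 - α)) * ∫ y in Set.Ioi z, h y t * (y - z) ^ (1 - α)
      = (α * b / π) * (D * J α t k (α - 2) z).re := by
    intro z hz
    have hs : ∫ y in Set.Ioi z, h y t * (y - z) ^ (1 - α)
        = ∫ v in Ioi (0:ℝ), h (z + v) t * v ^ (1 - α) := by
      have := (measurePreserving_add_left volume z).setIntegral_preimage_emb
        (measurableEmbedding_addLeft z) (fun y => h y t * (y - z) ^ (1 - α)) (Ioi z)
      rw [← this, Set.preimage_const_add_Ioi, sub_self]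
      simp only [add_sub_cancel_left]
    have h1 : ∀ v ∈ Ioi (0:ℝ), h (z + v) t * v ^ (1 - α) = (α * b / π) *
        RCLike.re (Complex.I * c * (J α t k 0 (z + v) * ((v ^ (1 - α) : ℝ) : ℂ))) := by
      intro v hv
      have hv' : 0 < v := hv
      rw [hJ _ _ (by linarith)]
      have : Complex.I * c * (J α t k 0 (z + v) * ((v ^ (1 - α) : ℝ) : ℂ)) =
        ((v ^ (1 - α) : ℝ) : ℂ) * (Complex.I * c * J α t k 0 (z + v)) := by ring
      rw [this, RCLike.re_eq_complex_re, Complex.re_ofReal_mul]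
      ring
    rw [hs, setIntegral_congr_fun measurableSet_Ioi h1, integral_const_mul,
      integral_re ((J_frac_int α t k z hα1 hα2 hkre hz).const_mul _), integral_const_mul,
      J_frac α t k z hα1 hα2 hkre hz, RCLike.re_eq_complex_re]
    have : Complex.I * c * ((1 / k) ^ ((2 - α : ℝ) : ℂ) * (Real.Gamma (2 - α) : ℂ) * J α t k (α - 2) z)
      = ((Real.Gamma (2 - α) : ℝ) : ℂ) * (D * J α t k (α - 2) z) := by rw [hD]; ring
    rw [this, Complex.re_ofReal_mul]
    field_simp
  set Φ : ℝ → ℝ := fun z => (1 / Real.Gamma (2 - α)) * ∫ y in Set.Ioi z, h y t * (y - z) ^ (1 - α) with hΦ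
  have gen : ∀ (E : ℂ) (s z : ℝ), -1 < s → 0 < z →
      HasDerivAt (fun z => (α * b / π) * (E * J α t k s z).re)
        ((α * b / π) * ((E * -k) * J α t k (s + 1) z).re) z := by
    intro E s z hs hz
    have h1 := (J_deriv_y α t k s z hs hkre hz).const_mul E
    have h2 := (Complex.reCLM.hasFDerivAt.comp_hasDerivAt z h1).const_mul (α * b / π)
    rw [mul_assoc E]
    exact h2
  have hΦ1 : ∀ z : ℝ, 0 < z → deriv Φ z = (α * b / π) * ((D * -k) * J α t k (α - 2 + 1) z).re := by
    intro z hz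
    have he : Φ =ᶠ[nhds z] fun z => (α * b / π) * (D * J α t k (α - 2) z).re := by
      filter_upwards [Ioi_mem_nhds hz] with w hw
      exact hI w hw
    rw [he.deriv_eq]
    exact (gen D (α - 2) z (by linarith) hz).deriv
  have hΦ2 : deriv (deriv Φ) x = (α * b / π) * ((D * -k * -k) * J α t k (α - 2 + 1 + 1) x).re := by
    have he : deriv Φ =ᶠ[nhds x] fun z => (α * b / π) * ((D * -k) * J α t k (α - 2 + 1) z).re := by
      filter_upwards [Ioi_mem_nhds hx] with w hw
      exact hΦ1 w hw
    rw [he.deriv_eq]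
    exact (gen (D * -k) (α - 2 + 1) x (by linarith) hx).deriv
  rw [hL.deriv, hΦ2, show α - 2 + 1 + 1 = α by ring, zero_add]
  have hfin : D * -k * -k * J α t k α x = ((b ^ α : ℝ) : ℂ) * (Complex.I * c * (-Complex.I * J α t k α x)) := by
    rw [hD]
    linear_combination (Complex.I * c * J α t k α x) * hconst
  rw [hfin, Complex.re_ofReal_mul, Real.rpow_neg hb.le]
  have : b ^ α ≠ 0 := (rpow_pos_of_pos hb α).ne'
  field_simp
end

section
/- Mittag-Leffler Laplace transform of the inverse stable subordinator density: Let 1/2 ≤ γ < 1, b > 0, let g_γ(x) = p_γ(x; γ, b), and let h(x,t) = (t/γ) x^{−1−1/γ} g_γ(t x^{−1/γ}) for x > 0. Then for all t > 0 and all z ≥ 0, ∫_0^∞ e^{−zx} h(x,t) dx = E_γ(−z b^{−1} t^γ), where E_γ is the Mittag-Leffler function. -/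
open MeasureTheory Real Set

/-- The Mittag-Leffler function `E_β(z) = Σ_{k=0}^∞ z^k / Γ(1 + βk)`. -/
noncomputable def mittagLeffler (β z : ℝ) : ℝ := ∑' k : ℕ, z ^ k / Real.Gamma (1 + β * k)

namespace ISL

/-- `exp(-b s^γ)`. -/
noncomputable def ff (γ b : ℝ) (s : ℂ) : ℂ := Complex.exp (-(b : ℂ) * s ^ (γ : ℂ))

/-- first derivative of `ff` -/
noncomputable def ffd (γ b : ℝ) (s : ℂ) : ℂ := -(b : ℂ) * ((γ : ℂ) * s ^ ((γ : ℂ) - 1)) * ff γ b s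

/-- second derivative of `ff` -/
noncomputable def ffdd (γ b : ℝ) (s : ℂ) : ℂ :=
  -(b : ℂ) * ((γ : ℂ) * (((γ : ℂ) - 1) * s ^ ((γ : ℂ) - 1 - 1))) * ff γ b s +
    -(b : ℂ) * ((γ : ℂ) * s ^ ((γ : ℂ) - 1)) * ffd γ b s

/-- vertical line -/
noncomputable def sl (R l : ℝ) : ℂ := (R : ℂ) - (l : ℂ) * Complex.I

/-- decay constant -/
noncomputable def dd (γ b : ℝ) : ℝ := b * Real.cos (π / 2 * γ)

lemma sl_re (R l : ℝ) : (sl R l).re = R := by simp [sl]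
lemma sl_im (R l : ℝ) : (sl R l).im = -l := by simp [sl]

lemma abs_le_norm_sl (R l : ℝ) : |l| ≤ ‖sl R l‖ := by
  have := Complex.abs_im_le_norm (sl R l)
  rwa [sl_im, abs_neg] at this

lemma le_norm_sl (R l : ℝ) : R ≤ ‖sl R l‖ := by
  have := Complex.re_le_norm (sl R l)
  rwa [sl_re] at this

lemma dd_pos {γ b : ℝ} (hγ0 : 0 < γ) (hγ2 : γ < 1) (hb : 0 < b) : 0 < dd γ b := by
  refine mul_pos hb (Real.cos_pos_of_mem_Ioo ⟨?_, ?_⟩) <;> nlinarith [Real.pi_pos]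

lemma norm_ff {γ b : ℝ} (hγ0 : 0 < γ) (hγ2 : γ < 1) (hb : 0 < b) {s : ℂ} (hs : 0 ≤ s.re) :
    ‖ff γ b s‖ ≤ Real.exp (-dd γ b * ‖s‖ ^ γ) := by
  rw [ff, Complex.norm_exp]
  refine Real.exp_le_exp.2 ?_
  have h1 : (s ^ (γ : ℂ)).re = ‖s‖ ^ γ * Real.cos (s.arg * γ) := by
    rw [Complex.cpow_ofReal, Complex.re_ofReal_mul]
    simp only [Complex.add_re, Complex.ofReal_re, Complex.re_ofReal_mul, Complex.I_re, mul_zero,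
      add_zero]
  rw [neg_mul, Complex.neg_re, Complex.re_ofReal_mul, h1, dd]
  have h2 : Real.cos (π / 2 * γ) ≤ Real.cos (s.arg * γ) := by
    rw [← Real.cos_abs (s.arg * γ), abs_mul, abs_of_pos hγ0]
    have := Complex.abs_arg_le_pi_div_two_iff.2 hs
    apply Real.cos_le_cos_of_nonneg_of_le_pi
    · positivity
    · nlinarith [Real.pi_pos]
    · exact mul_le_mul_of_nonneg_right this hγ0.le
  have h3 : 0 ≤ ‖s‖ ^ γ := by positivity
  nlinarith [mul_le_mul_of_nonneg_left h2 (mul_nonneg hb.le h3)]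

lemma norm_cpow' {γ : ℝ} (s : ℂ) : ‖s ^ ((γ : ℂ) - 1)‖ = ‖s‖ ^ (γ - 1) := by
  rw [← Complex.norm_cpow_real]; push_cast; rfl

lemma norm_cpow'' {γ : ℝ} (s : ℂ) : ‖s ^ ((γ : ℂ) - 1 - 1)‖ = ‖s‖ ^ (γ - 2) := by
  rw [← Complex.norm_cpow_real]; push_cast; ring_nf

lemma norm_ffd {γ b : ℝ} (hγ0 : 0 < γ) (hγ2 : γ < 1) (hb : 0 < b) {s : ℂ} (hs : 0 ≤ s.re) :
    ‖ffd γ b s‖ ≤ b * ‖s‖ ^ (γ - 1) * Real.exp (-dd γ b * ‖s‖ ^ γ) := by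
  rw [ffd, norm_mul, norm_mul, norm_mul, norm_cpow', norm_neg, Complex.norm_real, Complex.norm_real,
    Real.norm_of_nonneg hb.le, Real.norm_of_nonneg hγ0.le]
  refine mul_le_mul ?_ (norm_ff hγ0 hγ2 hb hs) (norm_nonneg _) (by positivity)
  refine mul_le_mul_of_nonneg_left ?_ hb.le
  exact mul_le_of_le_one_left (by positivity) hγ2.le

lemma norm_ffdd {γ b : ℝ} (hγ0 : 0 < γ) (hγ2 : γ < 1) (hb : 0 < b) {s : ℂ} (hs : 0 < s.re) :
    ‖ffdd γ b s‖ ≤ b * (1 + 2 * b / dd γ b) * ‖s‖ ^ (γ - 2) *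
      Real.exp (-(dd γ b / 2) * ‖s‖ ^ γ) := by
  have hd := dd_pos hγ0 hγ2 hb
  have hs0 : 0 < ‖s‖ := lt_of_lt_of_le hs (Complex.re_le_norm s)
  have h1 : ‖ffdd γ b s‖ ≤ b * (‖s‖ ^ (γ - 2)) * Real.exp (-dd γ b * ‖s‖ ^ γ) +
      b * ‖s‖ ^ (γ - 1) * (b * ‖s‖ ^ (γ - 1) * Real.exp (-dd γ b * ‖s‖ ^ γ)) := by
    rw [ffdd]
    refine (norm_add_le _ _).trans (add_le_add ?_ ?_)
    · rw [norm_mul, norm_mul, norm_mul, norm_mul, norm_cpow'', norm_neg, Complex.norm_real,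
        Complex.norm_real, Real.norm_of_nonneg hb.le, Real.norm_of_nonneg hγ0.le]
      refine mul_le_mul ?_ (norm_ff hγ0 hγ2 hb hs.le) (norm_nonneg _) (by positivity)
      refine mul_le_mul_of_nonneg_left ?_ hb.le
      have : ‖(γ : ℂ) - 1‖ ≤ 1 := by
        rw [← Complex.ofReal_one, ← Complex.ofReal_sub, Complex.norm_real, Real.norm_eq_abs,
          abs_le]; constructor <;> linarith
      rw [← mul_assoc]
      refine mul_le_of_le_one_left (by positivity) ?_
      exact mul_le_one₀ hγ2.le (norm_nonneg _) this
    · rw [norm_mul, norm_mul, norm_mul, norm_cpow', norm_neg, Complex.norm_real,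
        Complex.norm_real, Real.norm_of_nonneg hb.le, Real.norm_of_nonneg hγ0.le]
      refine mul_le_mul ?_ (norm_ffd hγ0 hγ2 hb hs.le) (norm_nonneg _) (by positivity)
      refine mul_le_mul_of_nonneg_left ?_ hb.le
      exact mul_le_of_le_one_left (by positivity) hγ2.le
  have h2 : ‖s‖ ^ (γ - 1) * ‖s‖ ^ (γ - 1) = ‖s‖ ^ (γ - 2) * ‖s‖ ^ γ := by
    rw [← Real.rpow_add hs0, ← Real.rpow_add hs0]; ring_nf
  have h3 : (1 + b * ‖s‖ ^ γ) * Real.exp (-dd γ b * ‖s‖ ^ γ) ≤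
      (1 + 2 * b / dd γ b) * Real.exp (-(dd γ b / 2) * ‖s‖ ^ γ) := by
    set x := ‖s‖ ^ γ with hx
    have hx0 : 0 ≤ x := by positivity
    have e1 : Real.exp (-dd γ b * x) =
      Real.exp (-(dd γ b / 2) * x) * Real.exp (-(dd γ b / 2) * x) := by
      rw [← Real.exp_add]; ring_nf
    have e2 : (1 + b * x) * Real.exp (-(dd γ b / 2) * x) ≤ 1 + 2 * b / dd γ b := by
      have : Real.exp (-(dd γ b / 2) * x) = (Real.exp (dd γ b / 2 * x))⁻¹ := by
        rw [← Real.exp_neg]; ring_nf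
      rw [this, ← div_eq_mul_inv, div_le_iff₀ (Real.exp_pos _)]
      have h4 := Real.add_one_le_exp (dd γ b / 2 * x)
      have h5 : (1 + b * x) ≤ (1 + 2 * b / dd γ b) * (dd γ b / 2 * x + 1) := by
        have : (1 + 2 * b / dd γ b) * (dd γ b / 2 * x + 1) =
          1 + b * x + (dd γ b / 2 * x + 2 * b / dd γ b) := by field_simp; ring
        rw [this]
        have : 0 ≤ dd γ b / 2 * x + 2 * b / dd γ b := by positivity
        linarith
      exact h5.trans (mul_le_mul_of_nonneg_left h4 (by positivity))
    rw [e1, ← mul_assoc]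
    exact mul_le_mul_of_nonneg_right e2 (Real.exp_pos _).le
  calc _ ≤ _ := h1
    _ = b * ‖s‖ ^ (γ - 2) * ((1 + b * ‖s‖ ^ γ) * Real.exp (-dd γ b * ‖s‖ ^ γ)) := by
      linear_combination (b * b * Real.exp (-dd γ b * ‖s‖ ^ γ)) * h2
    _ ≤ b * ‖s‖ ^ (γ - 2) * ((1 + 2 * b / dd γ b) * Real.exp (-(dd γ b / 2) * ‖s‖ ^ γ)) :=
      mul_le_mul_of_nonneg_left h3 (by positivity)
    _ = _ := by ring

lemma hasDerivAt_ff {γ b : ℝ} {s : ℂ} (hs : 0 < s.re) : HasDerivAt (ff γ b) (ffd γ b s) s := by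
  have h1 : HasDerivAt (fun s : ℂ => s ^ (γ : ℂ)) ((γ : ℂ) * s ^ ((γ : ℂ) - 1) * 1) s :=
    (hasDerivAt_id s).cpow_const (Or.inl hs)
  have := (h1.const_mul (-(b : ℂ))).cexp
  refine this.congr_deriv ?_
  simp only [ffd, ff]; ring

lemma hasDerivAt_ffd {γ b : ℝ} {s : ℂ} (hs : 0 < s.re) :
    HasDerivAt (ffd γ b) (ffdd γ b s) s := by
  have h1 : HasDerivAt (fun s : ℂ => s ^ ((γ : ℂ) - 1))
      (((γ : ℂ) - 1) * s ^ ((γ : ℂ) - 1 - 1) * 1) s :=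
    (hasDerivAt_id s).cpow_const (Or.inl hs)
  have := ((h1.const_mul (γ : ℂ)).const_mul (-(b : ℂ))).mul (hasDerivAt_ff (γ := γ) (b := b) hs)
  refine this.congr_deriv ?_
  simp only [ffdd]; ring

lemma measurable_ff (γ b : ℝ) : Measurable (ff γ b) := by
  unfold ff; fun_prop
lemma measurable_ffd (γ b : ℝ) : Measurable (ffd γ b) := by
  have := measurable_ff γ b
  unfold ffd; fun_prop
lemma measurable_ffdd (γ b : ℝ) : Measurable (ffdd γ b) := by
  have := measurable_ff γ b
  have := measurable_ffd γ b
  unfold ffdd; fun_prop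
lemma continuous_sl (R : ℝ) : Continuous (sl R) := by
  unfold sl; fun_prop
lemma continuous_sl' (l : ℝ) : Continuous (fun R => sl R l) := by
  unfold sl; fun_prop

lemma hasDerivAt_sl (R l : ℝ) : HasDerivAt (sl R) (-Complex.I) l := by
  have := ((Complex.ofRealCLM.hasDerivAt (x := l)).mul_const Complex.I).const_sub (R : ℂ)
  refine (this.congr_deriv ?_)
  simp

lemma hasDerivAt_sl' (R l : ℝ) : HasDerivAt (fun R => sl R l) 1 R := by
  have := ((Complex.ofRealCLM.hasDerivAt (x := R))).sub_const ((l : ℂ) * Complex.I)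
  refine (this.congr_deriv ?_)
  simp

/-- the integrable majorants -/
lemma integrable_maj {d γ q : ℝ} (hγ : 0 < γ) (hd : 0 < d) (hq : -1 < q) :
    Integrable (fun l : ℝ => |l| ^ q * Real.exp (-d * |l| ^ γ)) := by
  have h0 := integrableOn_rpow_mul_exp_neg_mul_rpow hq hγ hd
  have h1 : IntegrableOn (fun l : ℝ => |l| ^ q * Real.exp (-d * |l| ^ γ)) (Ioi 0) := by
    refine h0.congr_fun (fun x hx => ?_) measurableSet_Ioi
    simp only [abs_of_pos (mem_Ioi.1 hx)]
  have h2 : IntegrableOn (fun l : ℝ => |l| ^ q * Real.exp (-d * |l| ^ γ)) (Iio 0) := by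
    have := h1.comp_neg
    simpa using this
  rw [← integrableOn_univ, ← Iio_union_Ici (a := (0 : ℝ))]
  exact h2.union ((integrableOn_Ici_iff_integrableOn_Ioi enorm_ne_top).2 h1)

lemma integrable_maj0 {d γ : ℝ} (hγ : 0 < γ) (hd : 0 < d) :
    Integrable (fun l : ℝ => Real.exp (-d * |l| ^ γ)) := by
  simpa using integrable_maj (q := 0) hγ hd (by norm_num)

lemma exp_sl_le {d γ : ℝ} (hγ : 0 < γ) (hd : 0 < d) (R l : ℝ) :
    Real.exp (-d * ‖sl R l‖ ^ γ) ≤ Real.exp (-d * |l| ^ γ) := by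
  refine Real.exp_le_exp.2 ?_
  have := Real.rpow_le_rpow (abs_nonneg _) (abs_le_norm_sl R l) hγ.le
  nlinarith

lemma exp_sl_le' {d γ : ℝ} (hγ : 0 < γ) (hd : 0 < d) {R : ℝ} (hR : 0 ≤ R) (l : ℝ) :
    Real.exp (-d * ‖sl R l‖ ^ γ) ≤ Real.exp (-(d / 2) * R ^ γ) * Real.exp (-(d / 2) * |l| ^ γ) := by
  rw [← Real.exp_add]
  refine Real.exp_le_exp.2 ?_
  have := Real.rpow_le_rpow (abs_nonneg _) (abs_le_norm_sl R l) hγ.le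
  have := Real.rpow_le_rpow hR (le_norm_sl R l) hγ.le
  nlinarith

/-- contour integral along `Re s = R` -/
noncomputable def GI (γ b R u : ℝ) : ℂ := ∫ l : ℝ, Complex.exp (sl R l * (u : ℂ)) * ff γ b (sl R l)

/-- normalizing integral -/
noncomputable def C0 (γ b : ℝ) : ℝ := ∫ l : ℝ, Real.exp (-(dd γ b / 2) * |l| ^ γ)

lemma norm_cexp_sl (R l u : ℝ) : ‖Complex.exp (sl R l * (u : ℂ))‖ = Real.exp (R * u) := by
  rw [Complex.norm_exp, Complex.re_mul_ofReal, sl_re]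

lemma measurable_e (R u : ℝ) : Measurable fun l : ℝ => Complex.exp (sl R l * (u : ℂ)) := by
  have := continuous_sl R
  exact Continuous.measurable (by fun_prop)

lemma integrable_of_bound {f : ℂ → ℂ} (hf : Measurable f) {R : ℝ} (u : ℝ) {B : ℝ → ℝ}
    (hB : Integrable B) (h : ∀ᵐ l, ‖f (sl R l)‖ ≤ B l) :
    Integrable (fun l : ℝ => Complex.exp (sl R l * (u : ℂ)) * f (sl R l)) := by
  refine (hB.const_mul (Real.exp (R * u))).mono' ?_ ?_
  · exact ((measurable_e R u).mul (hf.comp (continuous_sl R).measurable)).aestronglyMeasurable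
  · filter_upwards [h] with l hl
    rw [norm_mul, norm_cexp_sl]
    exact mul_le_mul_of_nonneg_left hl (Real.exp_pos _).le

section
variable {γ b : ℝ} (hγ0 : 0 < γ) (hγ2 : γ < 1) (hb : 0 < b)

lemma ff_sl_le (hγ0 : 0 < γ) (hγ2 : γ < 1) (hb : 0 < b) {R : ℝ} (hR : 0 ≤ R) (l : ℝ) :
    ‖ff γ b (sl R l)‖ ≤ Real.exp (-dd γ b * |l| ^ γ) :=
  (norm_ff hγ0 hγ2 hb (by rwa [sl_re])).trans (exp_sl_le hγ0 (dd_pos hγ0 hγ2 hb) R l)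

lemma ffd_sl_le (hγ0 : 0 < γ) (hγ2 : γ < 1) (hb : 0 < b) {r R : ℝ} (hr : 0 < r) (hR : r ≤ R)
    (l : ℝ) :
    ‖ffd γ b (sl R l)‖ ≤ b * r ^ (γ - 1) * Real.exp (-dd γ b * |l| ^ γ) := by
  refine (norm_ffd hγ0 hγ2 hb (by rw [sl_re]; linarith)).trans ?_
  refine mul_le_mul ?_ (exp_sl_le hγ0 (dd_pos hγ0 hγ2 hb) R l) (Real.exp_pos _).le (by positivity)
  refine mul_le_mul_of_nonneg_left ?_ hb.le
  exact Real.rpow_le_rpow_of_nonpos hr (hR.trans (le_norm_sl R l)) (by linarith)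

/-- constant in the second derivative bound -/
noncomputable def C2 (γ b : ℝ) : ℝ := b * (1 + 2 * b / dd γ b)

lemma ffdd_sl_le (hγ0 : 0 < γ) (hγ2 : γ < 1) (hb : 0 < b) {R : ℝ} (hR : 0 < R) {l : ℝ}
    (hl : l ≠ 0) :
    ‖ffdd γ b (sl R l)‖ ≤ C2 γ b * R ^ (-(1 - γ / 2)) *
      (|l| ^ (-1 + γ / 2) * Real.exp (-(dd γ b / 2) * |l| ^ γ)) := by
  have hd := dd_pos hγ0 hγ2 hb
  have hC : 0 ≤ C2 γ b := by unfold C2; positivity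
  have hl' : 0 < |l| := abs_pos.2 hl
  have hs0 : 0 < ‖sl R l‖ := hR.trans_le (le_norm_sl R l)
  refine (norm_ffdd hγ0 hγ2 hb (by rwa [sl_re])).trans ?_
  have h1 : ‖sl R l‖ ^ (γ - 2) ≤ R ^ (-(1 - γ / 2)) * |l| ^ (-1 + γ / 2) := by
    have : ‖sl R l‖ ^ (γ - 2) = ‖sl R l‖ ^ (-(1 - γ / 2)) * ‖sl R l‖ ^ (-1 + γ / 2) := by
      rw [← Real.rpow_add hs0]; ring_nf
    rw [this]
    refine mul_le_mul ?_ ?_ (by positivity) (by positivity)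
    · exact Real.rpow_le_rpow_of_nonpos hR (le_norm_sl R l) (by linarith)
    · exact Real.rpow_le_rpow_of_nonpos hl' (abs_le_norm_sl R l) (by linarith)
  have h2 := exp_sl_le hγ0 (half_pos hd) R l
  calc _ ≤ C2 γ b * (R ^ (-(1 - γ / 2)) * |l| ^ (-1 + γ / 2)) *
        Real.exp (-(dd γ b / 2) * |l| ^ γ) := by
        refine mul_le_mul ?_ h2 (Real.exp_pos _).le (by positivity)
        exact mul_le_mul_of_nonneg_left h1 hC
    _ = _ := by ring

lemma integrable_eff (hγ0 : 0 < γ) (hγ2 : γ < 1) (hb : 0 < b) {R : ℝ} (hR : 0 ≤ R) (u : ℝ) :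
    Integrable (fun l : ℝ => Complex.exp (sl R l * (u : ℂ)) * ff γ b (sl R l)) :=
  integrable_of_bound (measurable_ff γ b) u (integrable_maj0 hγ0 (dd_pos hγ0 hγ2 hb))
    (Filter.Eventually.of_forall fun l => ff_sl_le hγ0 hγ2 hb hR l)

lemma integrable_effd (hγ0 : 0 < γ) (hγ2 : γ < 1) (hb : 0 < b) {R : ℝ} (hR : 0 < R) (u : ℝ) :
    Integrable (fun l : ℝ => Complex.exp (sl R l * (u : ℂ)) * ffd γ b (sl R l)) :=
  integrable_of_bound (measurable_ffd γ b) u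
    ((integrable_maj0 hγ0 (dd_pos hγ0 hγ2 hb)).const_mul _)
    (Filter.Eventually.of_forall fun l => ffd_sl_le hγ0 hγ2 hb hR le_rfl l)

lemma ae_ne : ∀ᵐ l : ℝ, l ≠ 0 := by
  simp [ae_iff, measure_singleton]

lemma integrable_effdd (hγ0 : 0 < γ) (hγ2 : γ < 1) (hb : 0 < b) {R : ℝ} (hR : 0 < R) (u : ℝ) :
    Integrable (fun l : ℝ => Complex.exp (sl R l * (u : ℂ)) * ffdd γ b (sl R l)) := by
  refine integrable_of_bound (measurable_ffdd γ b) u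
    ((integrable_maj (d := dd γ b / 2) (q := -1 + γ / 2) hγ0
      (half_pos (dd_pos hγ0 hγ2 hb)) (by linarith)).const_mul
        (C2 γ b * R ^ (-(1 - γ / 2)))) ?_
  filter_upwards [ae_ne] with l hl
  exact ffdd_sl_le hγ0 hγ2 hb hR hl

lemma norm_GI_le (hγ0 : 0 < γ) (hγ2 : γ < 1) (hb : 0 < b) {R : ℝ} (hR : 0 ≤ R) (u : ℝ) :
    ‖GI γ b R u‖ ≤ Real.exp (R * u) * Real.exp (-(dd γ b / 2) * R ^ γ) * C0 γ b := by
  have hd := dd_pos hγ0 hγ2 hb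
  unfold GI C0
  rw [← integral_const_mul]
  refine norm_integral_le_of_norm_le ((integrable_maj0 hγ0 (half_pos hd)).const_mul _) ?_
  refine Filter.Eventually.of_forall fun l => ?_
  rw [norm_mul, norm_cexp_sl, mul_assoc]
  refine mul_le_mul_of_nonneg_left ?_ (Real.exp_pos _).le
  exact (norm_ff hγ0 hγ2 hb (by rwa [sl_re])).trans (exp_sl_le' hγ0 hd hR l)

lemma hasDerivAt_e (u : ℝ) (s : ℂ) :
    HasDerivAt (fun s : ℂ => Complex.exp (s * (u : ℂ))) (Complex.exp (s * (u : ℂ)) * u) s := by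
  have := ((hasDerivAt_id s).mul_const (u : ℂ)).cexp
  simpa using this

lemma hasDerivAt_K (u : ℝ) {s : ℂ} (hs : 0 < s.re) :
    HasDerivAt (fun s : ℂ => Complex.exp (s * (u : ℂ)) * ff γ b s)
      (Complex.exp (s * (u : ℂ)) * (u * ff γ b s + ffd γ b s)) s := by
  refine ((hasDerivAt_e u s).mul (hasDerivAt_ff hs)).congr_deriv ?_
  ring

lemma hasDerivAt_P (u : ℝ) {s : ℂ} (hs : 0 < s.re) :
    HasDerivAt (fun s : ℂ => Complex.exp (s * (u : ℂ)) * (ffd γ b s - u * ff γ b s))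
      (Complex.exp (s * (u : ℂ)) * ffdd γ b s - u ^ 2 * (Complex.exp (s * (u : ℂ)) * ff γ b s))
      s := by
  refine ((hasDerivAt_e u s).mul ((hasDerivAt_ffd hs).sub
    ((hasDerivAt_ff hs).const_mul (u : ℂ)))).congr_deriv ?_
  simp only [Pi.sub_apply]
  ring

lemma GI_sq (hγ0 : 0 < γ) (hγ2 : γ < 1) (hb : 0 < b) {R : ℝ} (hR : 0 < R) (u : ℝ) :
    (u : ℂ) ^ 2 * GI γ b R u = ∫ l : ℝ, Complex.exp (sl R l * (u : ℂ)) * ffdd γ b (sl R l) := by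
  have i0 := integrable_eff hγ0 hγ2 hb hR.le u
  have i1 := integrable_effd hγ0 hγ2 hb hR u
  have i2 := integrable_effdd hγ0 hγ2 hb hR u
  have key := integral_eq_zero_of_hasDerivAt_of_integrable
    (f := fun l : ℝ => Complex.exp (sl R l * (u : ℂ)) *
      (ffd γ b (sl R l) - u * ff γ b (sl R l)))
    (f' := fun l : ℝ => (Complex.exp (sl R l * (u : ℂ)) * ffdd γ b (sl R l) -
      u ^ 2 * (Complex.exp (sl R l * (u : ℂ)) * ff γ b (sl R l))) * (-Complex.I))
    (fun l => (hasDerivAt_P (γ := γ) (b := b) u (s := sl R l)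
      (by rwa [sl_re])).comp l (hasDerivAt_sl R l))
    ((i2.sub (i0.const_mul _)).mul_const _)
    (by
      refine (i1.sub (i0.const_mul (u : ℂ))).congr (Filter.Eventually.of_forall fun l => ?_)
      simp only [Pi.sub_apply]
      ring)
  rw [integral_mul_const, integral_sub i2 (i0.const_mul _), integral_const_mul] at key
  have := (mul_eq_zero.1 key).resolve_right (by simp)
  rw [GI]
  exact (sub_eq_zero.1 this).symm

/-- tail constant -/
noncomputable def C3 (γ b : ℝ) : ℝ :=
  ∫ l : ℝ, |l| ^ (-1 + γ / 2) * Real.exp (-(dd γ b / 2) * |l| ^ γ)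

lemma norm_GI_sq_le (hγ0 : 0 < γ) (hγ2 : γ < 1) (hb : 0 < b) {R : ℝ} (hR : 0 < R) (u : ℝ) :
    u ^ 2 * ‖GI γ b R u‖ ≤ Real.exp (R * u) * (C2 γ b * R ^ (-(1 - γ / 2))) * C3 γ b := by
  have hd := dd_pos hγ0 hγ2 hb
  have : u ^ 2 * ‖GI γ b R u‖ = ‖(u : ℂ) ^ 2 * GI γ b R u‖ := by
    rw [norm_mul, norm_pow, Complex.norm_real, Real.norm_eq_abs, sq_abs]
  rw [this, GI_sq hγ0 hγ2 hb hR, C3, ← integral_const_mul]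
  refine norm_integral_le_of_norm_le ((integrable_maj (d := dd γ b / 2) (q := -1 + γ / 2) hγ0
      (half_pos (dd_pos hγ0 hγ2 hb)) (by linarith)).const_mul _) ?_
  filter_upwards [ae_ne] with l hl
  rw [norm_mul, norm_cexp_sl, mul_assoc]
  exact mul_le_mul_of_nonneg_left (ffdd_sl_le hγ0 hγ2 hb hR hl) (Real.exp_pos _).le

lemma hasDerivAt_GI (hγ0 : 0 < γ) (hγ2 : γ < 1) (hb : 0 < b) {R : ℝ} (hR : 0 < R) (u : ℝ) :
    HasDerivAt (fun R => GI γ b R u) 0 R := by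
  have hd := dd_pos hγ0 hγ2 hb
  have i0 := integrable_eff hγ0 hγ2 hb hR.le u
  have i1 := integrable_effd hγ0 hγ2 hb hR u
  have key := hasDerivAt_integral_of_dominated_loc_of_deriv_le (𝕜 := ℝ) (μ := volume) (x₀ := R)
    (s := Ioo (R / 2) (2 * R))
    (F := fun R l => Complex.exp (sl R l * (u : ℂ)) * ff γ b (sl R l))
    (F' := fun R l => Complex.exp (sl R l * (u : ℂ)) * (u * ff γ b (sl R l) + ffd γ b (sl R l)))
    (bound := fun l => (Real.exp (2 * R * |u|) * (|u| + b * (R / 2) ^ (γ - 1))) *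
      Real.exp (-dd γ b * |l| ^ γ))
    (Ioo_mem_nhds (by linarith) (by linarith))
    (Filter.Eventually.of_forall fun R => ((measurable_e R u).mul
      ((measurable_ff γ b).comp (continuous_sl R).measurable)).aestronglyMeasurable)
    i0
    ((measurable_e R u).mul ((((measurable_ff γ b).comp (continuous_sl R).measurable).const_mul
      (u : ℂ)).add ((measurable_ffd γ b).comp
        (continuous_sl R).measurable))).aestronglyMeasurable
    (Filter.Eventually.of_forall fun l => by
      intro r hr
      have hr0 : 0 < r := by linarith [hr.1]
      rw [norm_mul, norm_cexp_sl, mul_assoc]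
      refine mul_le_mul ?_ ?_ (norm_nonneg _) (Real.exp_pos _).le
      · refine Real.exp_le_exp.2 ?_
        calc r * u ≤ r * |u| := mul_le_mul_of_nonneg_left (le_abs_self u) hr0.le
          _ ≤ _ := mul_le_mul_of_nonneg_right hr.2.le (abs_nonneg u)
      · refine (norm_add_le _ _).trans ?_
        rw [norm_mul, Complex.norm_real, Real.norm_eq_abs, add_mul]
        refine add_le_add ?_ (ffd_sl_le hγ0 hγ2 hb (by linarith) hr.1.le l)
        exact mul_le_mul_of_nonneg_left (ff_sl_le hγ0 hγ2 hb hr0.le l) (abs_nonneg u))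
    ((integrable_maj0 hγ0 hd).const_mul _)
    (Filter.Eventually.of_forall fun l => by
      intro r hr
      have hr0 : 0 < r := by linarith [hr.1]
      have := (hasDerivAt_K (γ := γ) (b := b) u (s := sl r l)
        (by rwa [sl_re])).comp r (hasDerivAt_sl' r l)
      exact this.congr_deriv (mul_one _))
  have h0 := integral_eq_zero_of_hasDerivAt_of_integrable
    (f := fun l : ℝ => Complex.exp (sl R l * (u : ℂ)) * ff γ b (sl R l))
    (fun l => (hasDerivAt_K (γ := γ) (b := b) u (s := sl R l)
      (by rwa [sl_re])).comp l (hasDerivAt_sl R l))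
    (key.1.mul_const _) i0
  rw [integral_mul_const] at h0
  have := (mul_eq_zero.1 h0).resolve_right (by simp)
  have k2 := key.2
  rw [this] at k2
  exact k2

lemma continuousAt_ff (hγ0 : 0 < γ) {s : ℂ} (hs : 0 ≤ s.re) : ContinuousAt (ff γ b) s := by
  have : ContinuousAt (fun s : ℂ => s ^ (γ : ℂ)) s := by
    by_cases h : s = 0
    · subst h
      have h1 := Complex.continuousAt_cpow_zero_of_re_pos (z := (γ : ℂ)) (by simpa using hγ0)
      exact ContinuousAt.comp (f := fun s : ℂ => (s, (γ : ℂ))) h1 (by fun_prop)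
    · refine continuousAt_id.cpow continuousAt_const ?_
      rw [id, Complex.mem_slitPlane_iff]
      by_contra hcon
      push Not at hcon
      exact h (Complex.ext (le_antisymm hcon.1 hs) hcon.2)
  unfold ff
  fun_prop

lemma GI_eq (hγ0 : 0 < γ) (hγ2 : γ < 1) (hb : 0 < b) {R : ℝ} (hR : 0 ≤ R) (u : ℝ) :
    GI γ b R u = GI γ b 0 u := by
  rcases hR.eq_or_lt with rfl | hR
  · rfl
  have hc : ∀ r, 0 < r → GI γ b r u = GI γ b R u := by
    intro r hr
    exact isOpen_Ioi.is_const_of_deriv_eq_zero (𝕜 := ℝ) (s := Ioi (0 : ℝ))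
      (f := fun R => GI γ b R u) (convex_Ioi (0 : ℝ)).isPreconnected
      (fun x hx => (hasDerivAt_GI hγ0 hγ2 hb hx u).differentiableAt.differentiableWithinAt)
      (fun x hx => (hasDerivAt_GI hγ0 hγ2 hb hx u).deriv) hr hR
  have h1 : Filter.Tendsto (fun r => GI γ b r u) (nhdsWithin 0 (Ioi 0)) (nhds (GI γ b 0 u)) := by
    unfold GI
    refine tendsto_integral_filter_of_dominated_convergence
      (fun l => Real.exp |u| * Real.exp (-dd γ b * |l| ^ γ)) ?_ ?_
      ((integrable_maj0 hγ0 (dd_pos hγ0 hγ2 hb)).const_mul _) ?_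
    · exact (Filter.Eventually.of_forall fun R => ((measurable_e R u).mul
        ((measurable_ff γ b).comp (continuous_sl R).measurable)).aestronglyMeasurable)
    · filter_upwards [Ioo_mem_nhdsGT (zero_lt_one (α := ℝ))] with r hr
      refine Filter.Eventually.of_forall fun l => ?_
      rw [norm_mul, norm_cexp_sl]
      refine mul_le_mul ?_ (ff_sl_le hγ0 hγ2 hb hr.1.le l) (norm_nonneg _) (Real.exp_pos _).le
      refine Real.exp_le_exp.2 ?_
      calc r * u ≤ r * |u| := mul_le_mul_of_nonneg_left (le_abs_self u) hr.1.le
          _ ≤ 1 * |u| := mul_le_mul_of_nonneg_right hr.2.le (abs_nonneg u)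
          _ = _ := one_mul _
    · refine Filter.Eventually.of_forall fun l => ?_
      have c1 : ContinuousAt (fun r => ff γ b (sl r l)) 0 :=
        ContinuousAt.comp (f := fun r => sl r l)
          (continuousAt_ff (b := b) hγ0 (s := sl 0 l) (by rw [sl_re]))
          (continuous_sl' l).continuousAt
      have c2 := continuous_sl' l
      have c3 : ContinuousAt (fun r => Complex.exp (sl r l * (u : ℂ)) * ff γ b (sl r l)) 0 := by
        fun_prop
      exact c3.tendsto.mono_left nhdsWithin_le_nhds
  have h2 : Filter.Tendsto (fun r => GI γ b r u) (nhdsWithin 0 (Ioi 0)) (nhds (GI γ b R u)) := by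
    refine tendsto_const_nhds.congr' ?_
    filter_upwards [self_mem_nhdsWithin] with r hr
    exact (hc r hr).symm
  exact tendsto_nhds_unique h2 h1

end
section
variable {γ b : ℝ}

lemma C0_nonneg : 0 ≤ C0 γ b := integral_nonneg fun _ => (Real.exp_pos _).le

lemma continuous_GI (hγ0 : 0 < γ) (hγ2 : γ < 1) (hb : 0 < b) : Continuous (GI γ b 0) := by
  refine continuous_of_dominated (bound := fun l => Real.exp (-dd γ b * |l| ^ γ))
    (fun u => ((measurable_e 0 u).mul
      ((measurable_ff γ b).comp (continuous_sl 0).measurable)).aestronglyMeasurable) ?_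
    (integrable_maj0 hγ0 (dd_pos hγ0 hγ2 hb)) ?_
  · intro u
    refine Filter.Eventually.of_forall fun l => ?_
    rw [norm_mul, norm_cexp_sl, zero_mul, Real.exp_zero, one_mul]
    exact ff_sl_le hγ0 hγ2 hb le_rfl l
  · refine Filter.Eventually.of_forall fun l => ?_
    fun_prop

lemma GI_neg (hγ0 : 0 < γ) (hγ2 : γ < 1) (hb : 0 < b) {u : ℝ} (hu : u < 0) : GI γ b 0 u = 0 := by
  have hd := dd_pos hγ0 hγ2 hb
  have h1 : ∀ R : ℝ, 0 ≤ R → ‖GI γ b 0 u‖ ≤ Real.exp (R * u) * C0 γ b := by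
    intro R hR
    rw [← GI_eq hγ0 hγ2 hb hR u]
    refine (norm_GI_le hγ0 hγ2 hb hR u).trans ?_
    refine mul_le_mul_of_nonneg_right ?_ C0_nonneg
    refine mul_le_of_le_one_right (Real.exp_pos _).le ?_
    rw [Real.exp_le_one_iff]
    have : 0 ≤ R ^ γ := by positivity
    nlinarith
  have h2 : Filter.Tendsto (fun R : ℝ => Real.exp (R * u) * C0 γ b) Filter.atTop
      (nhds (0 * C0 γ b)) :=
    (Real.tendsto_exp_atBot.comp (Filter.tendsto_id.atTop_mul_const_of_neg hu)).mul_const _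
  rw [zero_mul] at h2
  have h3 : ‖GI γ b 0 u‖ ≤ 0 := by
    refine ge_of_tendsto h2 ?_
    filter_upwards [Filter.eventually_ge_atTop 0] with R hR using h1 R hR
  exact norm_le_zero_iff.1 h3

lemma GI_small (hγ0 : 0 < γ) (hγ2 : γ < 1) (hb : 0 < b) {c u : ℝ} (hc : 0 ≤ c) (hu : 0 < u) :
    Real.exp (c * u ^ (-γ)) * ‖GI γ b 0 u‖ ≤
      Real.exp ((c / (dd γ b / 2)) ^ (1 / γ)) * C0 γ b := by
  have hd := dd_pos hγ0 hγ2 hb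
  set A := (c / (dd γ b / 2)) ^ (1 / γ) with hA
  have hA0 : 0 ≤ A := by positivity
  have hAγ : A ^ γ = c / (dd γ b / 2) := by
    rw [hA, ← Real.rpow_mul (by positivity), one_div_mul_cancel hγ0.ne', Real.rpow_one]
  have h := norm_GI_le hγ0 hγ2 hb (R := A / u) (by positivity) u
  rw [GI_eq hγ0 hγ2 hb (by positivity), div_mul_cancel₀ _ hu.ne', Real.div_rpow hA0 hu.le, hAγ] at h
  have e : -(dd γ b / 2) * (c / (dd γ b / 2) / u ^ γ) = -(c * u ^ (-γ)) := by
    rw [Real.rpow_neg hu.le]; field_simp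
  rw [e, Real.exp_neg] at h
  calc _ ≤ Real.exp (c * u ^ (-γ)) *
        (Real.exp A * (Real.exp (c * u ^ (-γ)))⁻¹ * C0 γ b) :=
        mul_le_mul_of_nonneg_left h (Real.exp_pos _).le
    _ = _ := by
      have := (Real.exp_pos (c * u ^ (-γ))).ne'
      field_simp

lemma GI_tail (hγ0 : 0 < γ) (hγ2 : γ < 1) (hb : 0 < b) {u : ℝ} (hu : 0 < u) :
    ‖GI γ b 0 u‖ ≤ Real.exp 1 * C2 γ b * C3 γ b * u ^ (-1 - γ / 2) := by
  have h := norm_GI_sq_le hγ0 hγ2 hb (R := 1 / u) (by positivity) u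
  rw [GI_eq hγ0 hγ2 hb (by positivity), div_mul_cancel₀ _ hu.ne', one_div, Real.inv_rpow hu.le,
    ← Real.rpow_neg hu.le, neg_neg] at h
  have e : u ^ (1 - γ / 2) = u ^ 2 * u ^ (-1 - γ / 2) := by
    rw [← Real.rpow_natCast u 2, ← Real.rpow_add hu]; push_cast; ring_nf
  rw [e] at h
  have hu2 : 0 < u ^ 2 := by positivity
  refine le_of_mul_le_mul_left (h.trans (le_of_eq ?_)) hu2
  ring

lemma integrable_M (hγ0 : 0 < γ) (hγ2 : γ < 1) (hb : 0 < b) {c : ℝ} (hc : 0 ≤ c) :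
    IntegrableOn (fun u : ℝ => Real.exp (c * u ^ (-γ)) * ‖GI γ b 0 u‖) (Ioi 0) := by
  have hm : Measurable (fun u : ℝ => Real.exp (c * u ^ (-γ)) * ‖GI γ b 0 u‖) := by
    have := (continuous_GI hγ0 hγ2 hb).measurable
    fun_prop
  rw [← Ioc_union_Ioi_eq_Ioi (zero_le_one (α := ℝ))]
  refine IntegrableOn.union ?_ ?_
  · refine Integrable.mono' (g := fun _ => Real.exp ((c / (dd γ b / 2)) ^ (1 / γ)) * C0 γ b)
      (integrableOn_const (by simp)) hm.aestronglyMeasurable ?_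
    filter_upwards [ae_restrict_mem measurableSet_Ioc] with u hu
    rw [Real.norm_of_nonneg (by positivity)]
    exact GI_small hγ0 hγ2 hb hc hu.1
  · refine Integrable.mono'
      (g := fun u : ℝ => Real.exp c * (Real.exp 1 * C2 γ b * C3 γ b) * u ^ (-1 - γ / 2))
      ((integrableOn_Ioi_rpow_of_lt (by linarith) one_pos).const_mul _)
      hm.aestronglyMeasurable ?_
    filter_upwards [ae_restrict_mem measurableSet_Ioi] with u hu
    have hu1 : (1 : ℝ) < u := hu
    rw [Real.norm_of_nonneg (by positivity), mul_assoc]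
    refine mul_le_mul ?_ (GI_tail hγ0 hγ2 hb (by linarith)) (norm_nonneg _) (Real.exp_pos _).le
    refine Real.exp_le_exp.2 (mul_le_of_le_one_right hc ?_)
    exact Real.rpow_le_one_of_one_le_of_nonpos hu1.le (by linarith)

lemma integrable_GI (hγ0 : 0 < γ) (hγ2 : γ < 1) (hb : 0 < b) : Integrable (GI γ b 0) := by
  have h := integrable_M hγ0 hγ2 hb (c := 0) le_rfl
  have hc := continuous_GI hγ0 hγ2 hb
  have h1 : IntegrableOn (GI γ b 0) (Ioi 0) := by
    refine h.mono' hc.aestronglyMeasurable ?_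
    refine Filter.Eventually.of_forall fun u => ?_
    simp
  have h2 : IntegrableOn (GI γ b 0) (Iio 0) :=
    integrableOn_zero.congr_fun (fun u hu => (GI_neg hγ0 hγ2 hb hu).symm) measurableSet_Iio
  rw [← integrableOn_univ, ← Iio_union_Ici (a := (0 : ℝ))]
  exact h2.union ((integrableOn_Ici_iff_integrableOn_Ioi enorm_ne_top).2 h1)

lemma integrable_expGI (hγ0 : 0 < γ) (hγ2 : γ < 1) (hb : 0 < b) {R : ℝ} (hR : 0 ≤ R) :
    Integrable (fun u : ℝ => Complex.exp (-(R * u : ℝ)) * GI γ b 0 u) := by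
  have hc := continuous_GI hγ0 hγ2 hb
  refine (integrable_GI hγ0 hγ2 hb).norm.mono'
    (Continuous.aestronglyMeasurable (by fun_prop)) ?_
  refine Filter.Eventually.of_forall fun u => ?_
  rcases lt_or_ge u 0 with hu | hu
  · simp [GI_neg hγ0 hγ2 hb hu]
  · rw [norm_mul, Complex.norm_exp]
    refine mul_le_of_le_one_left (norm_nonneg _) ?_
    rw [Real.exp_le_one_iff, Complex.neg_re, Complex.ofReal_re]
    have := mul_nonneg hR hu
    linarith

lemma laplace_GI (hγ0 : 0 < γ) (hγ2 : γ < 1) (hb : 0 < b) {R : ℝ} (hR : 0 ≤ R) :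
    ∫ u in Ioi (0 : ℝ), Complex.exp (-(R * u : ℝ)) * GI γ b 0 u = 2 * π * ff γ b R := by
  set ψ : ℝ → ℂ := fun l => ff γ b (sl R l) with hψ
  have i0 : Integrable ψ := by
    have := integrable_eff hγ0 hγ2 hb hR 0
    simpa using this
  have hF : ∀ w : ℝ, FourierTransform.fourier ψ w =
      (fun u : ℝ => Complex.exp (-(R * u : ℝ)) * GI γ b 0 u) (2 * π * w) := by
    intro w
    rw [Real.fourier_real_eq_integral_exp_smul]
    simp only
    rw [← GI_eq hγ0 hγ2 hb hR, GI, ← integral_const_mul]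
    refine integral_congr_ae (Filter.Eventually.of_forall fun l => ?_)
    simp only [smul_eq_mul, hψ]
    rw [← mul_assoc, ← Complex.exp_add]
    congr 2
    simp only [sl]
    push_cast
    ring
  have hF' : FourierTransform.fourier ψ = fun w : ℝ =>
      (fun u : ℝ => Complex.exp (-(R * u : ℝ)) * GI γ b 0 u) (2 * π * w) := funext hF
  have hpi : (2 * π : ℝ) ≠ 0 := by positivity
  have i1 : Integrable (FourierTransform.fourier ψ) := by
    rw [hF']
    exact (integrable_expGI hγ0 hγ2 hb hR).comp_mul_left' hpi
  have hcont : ContinuousAt ψ 0 :=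
    ContinuousAt.comp (f := sl R) (continuousAt_ff (b := b) hγ0 (s := sl R 0) (by rwa [sl_re]))
          (continuous_sl R).continuousAt
  have key := i0.fourierInv_fourier_eq i1 hcont
  rw [Real.fourierInv_eq', hF'] at key
  simp only [inner_zero_right, mul_zero, Complex.ofReal_zero, zero_mul, Complex.exp_zero,
    one_smul] at key
  rw [Measure.integral_comp_mul_left (fun u : ℝ => Complex.exp (-(R * u : ℝ)) * GI γ b 0 u)] at key
  have hs : ∫ u in Ioi (0 : ℝ), Complex.exp (-(R * u : ℝ)) * GI γ b 0 u =
      ∫ u : ℝ, Complex.exp (-(R * u : ℝ)) * GI γ b 0 u := by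
    rw [← integral_Ici_eq_integral_Ioi]
    refine setIntegral_eq_integral_of_forall_compl_eq_zero fun u hu => ?_
    have : u < 0 := by simpa using hu
    rw [GI_neg hγ0 hγ2 hb this, mul_zero]
  have hsl : ψ 0 = ff γ b R := by simp [hψ, sl]
  rw [hs, ← hsl, ← key, abs_of_pos (by positivity), Complex.real_smul]
  push_cast
  have : (π : ℂ) ≠ 0 := by exact_mod_cast Real.pi_ne_zero
  field_simp

end
section
variable {γ b : ℝ}

lemma integrable_mom (hγ0 : 0 < γ) (hγ2 : γ < 1) (hb : 0 < b) (k : ℕ) :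
    IntegrableOn (fun u : ℝ => (u ^ (-γ)) ^ k * ‖GI γ b 0 u‖) (Ioi 0) := by
  have hm : Measurable (fun u : ℝ => (u ^ (-γ)) ^ k * ‖GI γ b 0 u‖) := by
    have := (continuous_GI hγ0 hγ2 hb).measurable
    fun_prop
  refine ((integrable_M hγ0 hγ2 hb (c := 1) zero_le_one).const_mul (k.factorial : ℝ)).mono'
    hm.aestronglyMeasurable ?_
  filter_upwards [ae_restrict_mem measurableSet_Ioi] with u hu
  have hu0 : 0 < u := hu
  rw [Real.norm_of_nonneg (by positivity), ← mul_assoc]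
  refine mul_le_mul_of_nonneg_right ?_ (norm_nonneg _)
  have h := Real.pow_div_factorial_le_exp (u ^ (-γ)) (by positivity) k
  rw [div_le_iff₀ (by positivity)] at h
  rw [one_mul]
  linarith

lemma ff_real {s : ℝ} (hs : 0 ≤ s) :
    ff γ b s = ((Real.exp (-b * s ^ γ) : ℝ) : ℂ) := by
  rw [ff, ← Complex.ofReal_cpow hs]; push_cast; rfl

lemma moment_pos (hγ0 : 0 < γ) (hγ2 : γ < 1) (hb : 0 < b) {k : ℕ} (hk : 0 < k) :
    ∫ u in Ioi (0 : ℝ), (((u ^ (-γ)) ^ k : ℝ) : ℂ) * GI γ b 0 u =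
      2 * π * ((k.factorial * (b⁻¹) ^ k / Real.Gamma (1 + γ * k) : ℝ) : ℂ) := by
  have hk' : (0 : ℝ) < k := by exact_mod_cast hk
  set a : ℝ := γ * k with ha
  have ha0 : 0 < a := by positivity
  have hG := Real.Gamma_pos_of_pos ha0
  have hc := continuous_GI hγ0 hγ2 hb
  have hmeas : Measurable (Function.uncurry fun (u s : ℝ) =>
      ((s ^ (a - 1) * Real.exp (-(u * s)) : ℝ) : ℂ) * GI γ b 0 u) := by
    have := hc.measurable
    unfold Function.uncurry
    fun_prop
  have hpow : ∀ u : ℝ, 0 < u → (1 / u) ^ a = (u ^ (-γ)) ^ k := by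
    intro u hu
    rw [one_div, Real.inv_rpow hu.le, ← Real.rpow_neg hu.le, ← Real.rpow_natCast,
      ← Real.rpow_mul hu.le, ha, neg_mul]
  have hint : Integrable (Function.uncurry fun (u s : ℝ) =>
      ((s ^ (a - 1) * Real.exp (-(u * s)) : ℝ) : ℂ) * GI γ b 0 u)
      ((volume.restrict (Ioi 0)).prod (volume.restrict (Ioi 0))) := by
    rw [integrable_prod_iff hmeas.aestronglyMeasurable]
    constructor
    · filter_upwards [ae_restrict_mem measurableSet_Ioi] with u hu
      have := integrableOn_rpow_mul_exp_neg_mul_rpow (p := 1) (s := a - 1) (b := u)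
        (by linarith) one_pos hu
      simp only [Real.rpow_one] at this
      simp only [Function.uncurry]
      have h' : Integrable (fun s : ℝ => s ^ (a - 1) * Real.exp (-(u * s)))
          (volume.restrict (Ioi 0)) := by
        simpa [neg_mul, IntegrableOn] using this
      exact h'.ofReal.mul_const _
    · refine ((integrable_mom hγ0 hγ2 hb k).const_mul (Real.Gamma a)).congr ?_
      filter_upwards [ae_restrict_mem measurableSet_Ioi] with u hu
      have hu0 : 0 < u := hu
      simp only [Function.uncurry]
      rw [← hpow u hu0, ← mul_assoc, mul_comm (Real.Gamma a),
        ← Real.integral_rpow_mul_exp_neg_mul_Ioi ha0 hu0, ← integral_mul_const]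
      refine setIntegral_congr_fun measurableSet_Ioi fun s hs => ?_
      have hs0 : 0 < s := hs
      rw [norm_mul, Complex.norm_real, Real.norm_of_nonneg (by positivity)]
  have hswap := integral_integral_swap hint
  have hL : ∫ u in Ioi (0 : ℝ), ∫ s in Ioi (0 : ℝ),
      ((s ^ (a - 1) * Real.exp (-(u * s)) : ℝ) : ℂ) * GI γ b 0 u =
      (Real.Gamma a : ℂ) * ∫ u in Ioi (0 : ℝ), (((u ^ (-γ)) ^ k : ℝ) : ℂ) * GI γ b 0 u := by
    rw [← integral_const_mul]
    refine setIntegral_congr_fun measurableSet_Ioi fun u hu => ?_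
    rw [integral_mul_const, integral_complex_ofReal, Real.integral_rpow_mul_exp_neg_mul_Ioi ha0 hu,
      hpow u hu]
    push_cast
    ring
  have hR : ∫ s in Ioi (0 : ℝ), ∫ u in Ioi (0 : ℝ),
      ((s ^ (a - 1) * Real.exp (-(u * s)) : ℝ) : ℂ) * GI γ b 0 u =
      2 * π * ((b ^ (-a / γ) * (1 / γ) * Real.Gamma (a / γ) : ℝ) : ℂ) := by
    have e := integral_rpow_mul_exp_neg_mul_rpow (p := γ) (q := a - 1) (b := b) hγ0
      (by linarith) hb
    rw [sub_add_cancel] at e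
    rw [← e, ← integral_complex_ofReal, ← integral_const_mul]
    refine setIntegral_congr_fun measurableSet_Ioi fun s hs => ?_
    have hs0 : 0 < s := hs
    have l := laplace_GI hγ0 hγ2 hb hs0.le
    rw [ff_real hs0.le] at l
    calc _ = ∫ u in Ioi (0 : ℝ), ((s ^ (a - 1) : ℝ) : ℂ) *
          (Complex.exp (-(s * u : ℝ)) * GI γ b 0 u) := by
          refine setIntegral_congr_fun measurableSet_Ioi fun u hu => ?_
          rw [mul_comm s u]
          push_cast
          ring
      _ = _ := by
        rw [integral_const_mul, l]
        push_cast
        ring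
  rw [hL, hR] at hswap
  have haγ : a / γ = k := by rw [ha]; field_simp
  have hGa : Real.Gamma (1 + a) = a * Real.Gamma a := by
    rw [add_comm, Real.Gamma_add_one ha0.ne']
  have hf : (k.factorial : ℝ) = k * Real.Gamma k := by
    rw [← Real.Gamma_add_one hk'.ne', Real.Gamma_nat_eq_factorial]
  have hbk : b ^ (-a / γ) = (b⁻¹) ^ k := by
    rw [neg_div, haγ, Real.rpow_neg hb.le, Real.rpow_natCast, inv_pow]
  have hGc : (Real.Gamma a : ℂ) ≠ 0 := by exact_mod_cast hG.ne'
  refine mul_left_cancel₀ hGc (hswap.trans ?_)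
  rw [hGa, hbk, haγ, hf]
  have : k * Real.Gamma k * b⁻¹ ^ k / (a * Real.Gamma a) =
    (b⁻¹ ^ k * (1 / γ) * Real.Gamma k) / Real.Gamma a := by
    rw [ha]; field_simp
  rw [this]
  push_cast
  field_simp

lemma moment (hγ0 : 0 < γ) (hγ2 : γ < 1) (hb : 0 < b) (k : ℕ) :
    ∫ u in Ioi (0 : ℝ), (((u ^ (-γ)) ^ k : ℝ) : ℂ) * GI γ b 0 u =
      2 * π * ((k.factorial * (b⁻¹) ^ k / Real.Gamma (1 + γ * k) : ℝ) : ℂ) := by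
  rcases Nat.eq_zero_or_pos k with rfl | hk
  · have := laplace_GI hγ0 hγ2 hb (R := 0) le_rfl
    rw [ff_real le_rfl, Real.zero_rpow hγ0.ne'] at this
    simpa using this
  · exact moment_pos hγ0 hγ2 hb hk

lemma hasSum_GI (hγ0 : 0 < γ) (hγ2 : γ < 1) (hb : 0 < b) {c : ℝ} (hc : 0 ≤ c) :
    HasSum (fun k : ℕ => 2 * π * (((-(c * b⁻¹)) ^ k / Real.Gamma (1 + γ * k) : ℝ) : ℂ))
      (∫ u in Ioi (0 : ℝ), ((Real.exp (-(c * u ^ (-γ))) : ℝ) : ℂ) * GI γ b 0 u) := by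
  have hm := (continuous_GI hγ0 hγ2 hb).measurable
  have hsum : ∀ x : ℝ, HasSum (fun k : ℕ => x ^ k / k.factorial) (Real.exp x) := by
    intro x
    rw [Real.exp_eq_exp_ℝ]
    exact NormedSpace.expSeries_div_hasSum_exp x
  have h := hasSum_integral_of_dominated_convergence (μ := volume.restrict (Ioi (0 : ℝ)))
    (F := fun (k : ℕ) (u : ℝ) =>
      (((-(c * u ^ (-γ))) ^ k / k.factorial : ℝ) : ℂ) * GI γ b 0 u)
    (f := fun u => ((Real.exp (-(c * u ^ (-γ))) : ℝ) : ℂ) * GI γ b 0 u)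
    (fun k u => (c * u ^ (-γ)) ^ k / k.factorial * ‖GI γ b 0 u‖)
    (fun k => by
      refine Measurable.aestronglyMeasurable ?_
      fun_prop)
    (fun k => by
      filter_upwards [ae_restrict_mem measurableSet_Ioi] with u hu
      have hu0 : 0 < u := hu
      rw [norm_mul, Complex.norm_real, norm_div, norm_pow, norm_neg, Real.norm_of_nonneg
        (by positivity : 0 ≤ c * u ^ (-γ)), Real.norm_of_nonneg (by positivity)])
    (Filter.Eventually.of_forall fun u => (hsum _).summable.mul_right _)
    (by
      refine (integrable_M hγ0 hγ2 hb hc).congr (Filter.Eventually.of_forall fun u => ?_)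
      simp only
      rw [tsum_mul_right, (hsum _).tsum_eq])
    (Filter.Eventually.of_forall fun u => by
      exact (Complex.hasSum_ofReal.2 (hsum (-(c * u ^ (-γ))))).mul_right _)
  suffices hfun : (fun k : ℕ =>
      2 * π * (((-(c * b⁻¹)) ^ k / Real.Gamma (1 + γ * k) : ℝ) : ℂ)) = fun k : ℕ =>
      ∫ u in Ioi (0 : ℝ), (((-(c * u ^ (-γ))) ^ k / k.factorial : ℝ) : ℂ) * GI γ b 0 u by
    rw [hfun]; exact h
  funext k
  have e : ∀ u : ℝ, (((-(c * u ^ (-γ))) ^ k / k.factorial : ℝ) : ℂ) * GI γ b 0 u =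
      (((-c) ^ k / k.factorial : ℝ) : ℂ) * ((((u ^ (-γ)) ^ k : ℝ) : ℂ) * GI γ b 0 u) := by
    intro u
    rw [← mul_assoc, ← Complex.ofReal_mul, ← neg_mul, mul_pow]
    congr 2
    ring
  simp only [e]
  rw [integral_const_mul, moment hγ0 hγ2 hb, ← neg_mul, mul_pow, mul_left_comm,
    ← Complex.ofReal_mul]
  congr 2
  have : (k.factorial : ℝ) ≠ 0 := by positivity
  field_simp

lemma zol_eq (x : ℝ) : zolDensity γ γ b x = (1 / (2 * π)) * (GI γ b 0 x).re := by
  unfold zolDensity GI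
  congr 2
  refine integral_congr_ae ?_
  filter_upwards [ae_ne] with l hl
  have h1 : sl 0 l * (x : ℂ) = -Complex.I * (l : ℂ) * (x : ℂ) := by
    simp only [sl]; push_cast; ring
  have h2 : (sl 0 l) ^ (γ : ℂ) = ((|l| ^ γ : ℝ) : ℂ) *
      Complex.exp (-Complex.I * (π : ℂ) * (γ : ℂ) * ((Real.sign l : ℝ) : ℂ) / 2) := by
    rw [Real.rpow_def_of_pos (abs_pos.2 hl), Complex.ofReal_exp, ← Complex.exp_add]
    rcases lt_or_gt_of_ne hl with h | h
    · have : sl 0 l = ((-l : ℝ) : ℂ) * Complex.I := by simp [sl]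
      rw [this, Complex.cpow_def_of_ne_zero (by simpa using hl),
        Complex.log_ofReal_mul (by linarith) (by simp), Complex.log_I, Real.sign_of_neg h,
        abs_of_neg h]
      congr 1
      push_cast
      ring
    · have : sl 0 l = ((l : ℝ) : ℂ) * (-Complex.I) := by simp [sl]
      rw [this, Complex.cpow_def_of_ne_zero (by simpa using hl),
        Complex.log_ofReal_mul h (by simp), Complex.log_neg_I, Real.sign_of_pos h,
        abs_of_pos h]
      congr 1
      push_cast
      ring
  rw [h1, ff, h2, mul_assoc (-(b : ℂ))]

lemma real_laplace (hγ0 : 0 < γ) (hγ2 : γ < 1) (hb : 0 < b) {c : ℝ} (hc : 0 ≤ c) :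
    ∫ u in Ioi (0 : ℝ), Real.exp (-(c * u ^ (-γ))) * zolDensity γ γ b u =
      mittagLeffler γ (-(c * b⁻¹)) := by
  have h := hasSum_GI hγ0 hγ2 hb hc
  have hi : Integrable (fun u : ℝ => ((Real.exp (-(c * u ^ (-γ))) : ℝ) : ℂ) * GI γ b 0 u)
      (volume.restrict (Ioi 0)) := by
    have hm := (continuous_GI hγ0 hγ2 hb).measurable
    refine (integrable_GI hγ0 hγ2 hb).integrableOn.norm.mono'
      (Measurable.aestronglyMeasurable (by fun_prop)) ?_
    filter_upwards [ae_restrict_mem measurableSet_Ioi] with u hu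
    have hu0 : 0 < u := hu
    rw [norm_mul, Complex.norm_real, Real.norm_of_nonneg (Real.exp_pos _).le]
    refine mul_le_of_le_one_left (norm_nonneg _) ?_
    rw [Real.exp_le_one_iff]
    have : 0 ≤ c * u ^ (-γ) := by positivity
    linarith
  have h2 := Complex.hasSum_re h
  have e1 : (∫ u in Ioi (0 : ℝ), ((Real.exp (-(c * u ^ (-γ))) : ℝ) : ℂ) * GI γ b 0 u).re =
      ∫ u in Ioi (0 : ℝ), Real.exp (-(c * u ^ (-γ))) * (GI γ b 0 u).re := by
    have := integral_re (𝕜 := ℂ) hi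
    simp only [RCLike.re_eq_complex_re, Complex.re_ofReal_mul] at this
    exact this.symm
  rw [e1] at h2
  have e2 : ∀ r : ℝ, (2 * (π : ℂ) * (r : ℂ)).re = 2 * π * r := by
    intro r
    rw [show 2 * (π : ℂ) * (r : ℂ) = ((2 * π * r : ℝ) : ℂ) by push_cast; ring, Complex.ofReal_re]
  simp only [e2] at h2
  have h3 := h2.mul_left (1 / (2 * π))
  have e3 : ∫ u in Ioi (0 : ℝ), Real.exp (-(c * u ^ (-γ))) * zolDensity γ γ b u =
      (1 / (2 * π)) * ∫ u in Ioi (0 : ℝ), Real.exp (-(c * u ^ (-γ))) * (GI γ b 0 u).re := by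
    rw [← integral_const_mul]
    refine setIntegral_congr_fun measurableSet_Ioi fun u _ => ?_
    simp only [zol_eq]
    ring
  rw [e3, ← h3.tsum_eq, mittagLeffler]
  refine tsum_congr fun k => ?_
  have := Real.pi_pos
  field_simp

end

end ISL

/-- Mittag-Leffler Laplace transform of the inverse stable subordinator density. -/
theorem inverse_subordinator_laplace (γ b : ℝ) (hγ1 : 1 / 2 ≤ γ) (hγ2 : γ < 1) (hb : 0 < b)
    (g : ℝ → ℝ) (hg : ∀ x, g x = zolDensity γ γ b x)
    (h : ℝ → ℝ → ℝ)
    (hh : ∀ x t, h x t = (t / γ) * x ^ (-1 - 1 / γ) * g (t * x ^ (-(1 / γ)))) :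
    ∀ t z : ℝ, 0 < t → 0 ≤ z →
      ∫ x in Set.Ioi (0 : ℝ), Real.exp (-(z * x)) * h x t =
        mittagLeffler γ (-(z * b⁻¹ * t ^ γ)) := by
  intro t z ht hz
  have hγ0 : 0 < γ := by linarith
  have hc : 0 ≤ z * t ^ γ := by positivity
  have main := ISL.real_laplace hγ0 hγ2 hb hc
  have e : z * b⁻¹ * t ^ γ = z * t ^ γ * b⁻¹ := by ring
  rw [e, ← main]
  have hp : -(1 / γ) ≠ 0 := by
    have : 0 < 1 / γ := by positivity
    linarith
  have s1 := integral_comp_mul_left_Ioi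
    (fun u : ℝ => Real.exp (-(z * t ^ γ * u ^ (-γ))) * zolDensity γ γ b u) 0 ht
  rw [mul_zero] at s1
  have s2 := integral_comp_rpow_Ioi
    (fun y : ℝ => t * (Real.exp (-(z * t ^ γ * (t * y) ^ (-γ))) * zolDensity γ γ b (t * y))) hp
  rw [integral_const_mul, s1, smul_eq_mul, ← mul_assoc, mul_inv_cancel₀ ht.ne', one_mul] at s2
  rw [← s2]
  refine setIntegral_congr_fun measurableSet_Ioi fun x hx => ?_
  have hx0 : 0 < x := hx
  have h1 : (t * x ^ (-(1 / γ))) ^ (-γ) = (t ^ γ)⁻¹ * x := by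
    rw [Real.mul_rpow ht.le (by positivity), Real.rpow_neg ht.le, ← Real.rpow_mul hx0.le,
      neg_mul_neg, one_div_mul_cancel hγ0.ne', Real.rpow_one]
  have h2 : z * t ^ γ * ((t ^ γ)⁻¹ * x) = z * x := by
    have : t ^ γ ≠ 0 := by positivity
    field_simp
  have h3 : |-(1 / γ)| = 1 / γ := by rw [abs_neg, abs_of_pos (by positivity)]
  have h4 : -(1 / γ) - 1 = -1 - 1 / γ := by ring
  simp only [smul_eq_mul]
  rw [h1, h2, h3, h4, hh, hg]
  ring
end
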